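/- arXiv:1007.5265 — 2 statements merged into one kernel-verified Lean document; each statement's English description precedes it below -/
import Mathlib

section
/- Let R be an integral domain and * a semistar operation on R with R^* = R that is of finite type and satisfies (F ∩ G)^* = F^* ∩ G^* for all nonzero R-submodules F, G of K (i.e. * is spectral and of finite type). Assume R is Boole *-regular. Let D := {x ∈ K : xJ^* ⊆ J^* for some nonzero finitely generated ideal J of R} be the *-integral closure of R. Then D is a GCD-domain; more precisely, for every nonzero finitely generated D-submodule F of K there exists x ∈ K with F^* = xD. -/
open scoped Pointwise

section Defs

variable (A K : Type*) [CommRing A] [Field K] [Algebra A K]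

/-- `I` is a nonzero fractional ideal of `A` (inside `K`):
`I ≠ 0` and `dI ⊆ A` for some nonzero `d ∈ A`. -/
def IsFrac (I : Submodule A K) : Prop :=
  I ≠ ⊥ ∧ ∃ d : A, d ≠ 0 ∧ ∀ x ∈ I, ∃ a : A, algebraMap A K d * x = algebraMap A K a

/-- The divisorial closure `I^v = (A : (A : I))`; here `(J : I) = J / I` and
`(1 : Submodule A K)` is the image of `A` in `K`. -/
def vS (I : Submodule A K) : Submodule A K := 1 / (1 / I)

/-- The `t`-operation `I^t = ⋃ {J^v : J ⊆ I nonzero finitely generated}` (a directed union,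
hence equal to the supremum of submodules). -/
def tS (I : Submodule A K) : Submodule A K :=
  ⨆ J ∈ {J : Submodule A K | J ≠ ⊥ ∧ J.FG ∧ J ≤ I}, vS A K J

/-- The image of an integral ideal of `A` in `K`. -/
def idealK (I : Ideal A) : Submodule A K := Submodule.map (Algebra.linearMap A K) I

/-- A nonzero (fractional) ideal `I` is stable if `I((I:I):I) = (I:I)`. -/
def IsStableIdeal (I : Submodule A K) : Prop := I * ((I / I) / I) = I / I

/-- `A` is a stable domain: every nonzero (fractional) ideal is stable. -/
def StableDomain : Prop := ∀ I : Submodule A K, IsFrac A K I → IsStableIdeal A K I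

/-- `A` is Clifford regular: every nonzero (fractional) ideal `I` satisfies `I = I²J`
for some nonzero `A`-submodule `J` of `K`. -/
def CliffordRegularDomain : Prop :=
  ∀ I : Submodule A K, IsFrac A K I → ∃ J : Submodule A K, J ≠ ⊥ ∧ I = I * I * J

end Defs

section Semistar

variable (A K : Type*) [CommRing A] [Field K] [Algebra A K]

/-- A semistar operation on the domain `A` (inside `K`): a map on nonzero `A`-submodules of
`K` satisfying `(aF)^* = aF^*`, `F ⊆ F^*`, monotonicity, and idempotency. -/
structure SemistarOp : Type _ where
  star : Submodule A K → Submodule A K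
  star_ne_bot : ∀ F : Submodule A K, F ≠ ⊥ → star F ≠ ⊥
  star_smul : ∀ (a : K), a ≠ 0 → ∀ F : Submodule A K, F ≠ ⊥ → star (a • F) = a • star F
  le_star : ∀ F : Submodule A K, F ≠ ⊥ → F ≤ star F
  star_mono : ∀ F G : Submodule A K, F ≠ ⊥ → G ≠ ⊥ → F ≤ G → star F ≤ star G
  star_star : ∀ F : Submodule A K, F ≠ ⊥ → star (star F) = star F

end Semistar

section PointwiseSubmodule

variable {R K : Type*} [CommRing R] [Field K] [Algebra R K]

theorem Submodule.smul_le_iff_forall_mul_mem {a : K} {F G : Submodule R K} :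
    a • F ≤ G ↔ ∀ y ∈ F, a * y ∈ G := by
  constructor
  · exact fun h y hy => h (Submodule.smul_mem_pointwise_smul y a F hy)
  · rintro h _ hz
    obtain ⟨y, hy, rfl⟩ := (Submodule.mem_smul_pointwise_iff_exists _ _ _).1 hz
    exact h y hy

theorem Submodule.smul_ne_bot {a : K} (ha : a ≠ 0) {F : Submodule R K} (hF : F ≠ ⊥) :
    a • F ≠ ⊥ := by
  obtain ⟨y, hy, hy0⟩ := F.ne_bot_iff.1 hF
  exact (Submodule.ne_bot_iff _).2
    ⟨a * y, Submodule.smul_mem_pointwise_smul y a F hy, mul_ne_zero ha hy0⟩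

theorem Submodule.FG.pointwise_smul {F : Submodule R K} (hF : F.FG) (a : K) : (a • F).FG :=
  hF.map _

theorem Submodule.one_inf_ne_bot [IsFractionRing R K] {F : Submodule R K}
    (hF : F ≠ ⊥) : 1 ⊓ F ≠ ⊥ := by
  obtain ⟨y, hy, hy0⟩ := F.ne_bot_iff.1 hF
  obtain ⟨a, b, hb, rfl⟩ := IsFractionRing.div_surjective (A := R) y
  have := (algebraMap R K).domain_nontrivial
  have hb0 : algebraMap R K b ≠ 0 := IsFractionRing.to_map_ne_zero_of_mem_nonZeroDivisors hb
  refine (Submodule.ne_bot_iff _).2 ⟨algebraMap R K a, ⟨Submodule.mem_one.2 ⟨a, rfl⟩, ?_⟩, ?_⟩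
  · have := F.smul_mem b hy
    rwa [Algebra.smul_def, mul_div_cancel₀ _ hb0] at this
  · intro h
    simp [h] at hy0

theorem isFrac_of_fg [IsDomain R] [IsFractionRing R K] {F : Submodule R K} (hF : F ≠ ⊥)
    (hfg : F.FG) : IsFrac R K F := by
  obtain ⟨d, hd, h⟩ := FractionalIdeal.isFractional_of_fg (S := nonZeroDivisors R) hfg
  refine ⟨hF, d, nonZeroDivisors.ne_zero hd, fun x hx => ?_⟩
  obtain ⟨a, ha⟩ := h x hx
  exact ⟨a, by rw [ha, Algebra.smul_def]⟩

/-- A form of Nakayama's lemma for a multiplicatively closed submodule `E` of a field. -/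
theorem Submodule.one_mem_of_fg_of_le_mul {E H : Submodule R K} (hE : E * E ≤ E) (hH : H ≠ ⊥)
    (hfg : H.FG) (h : H ≤ E * H) : (1 : K) ∈ E := by
  let S : Subalgebra R K :=
    { carrier := {a | ∀ x ∈ E, a * x ∈ E}
      mul_mem' := fun {a b} ha hb x hx => by
        rw [mul_assoc]
        exact ha _ (hb x hx)
      add_mem' := fun {a b} ha hb x hx => by
        rw [add_mul]
        exact E.add_mem (ha x hx) (hb x hx)
      algebraMap_mem' := fun r x hx => by
        rw [← Algebra.smul_def]
        exact E.smul_mem r hx }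
  have hES : ∀ e ∈ E, e ∈ S := fun e he x hx => hE (Submodule.mul_mem_mul he hx)
  let I : Ideal S :=
    { carrier := {a | (a : K) ∈ E}
      zero_mem' := E.zero_mem
      add_mem' := fun ha hb => E.add_mem ha hb
      smul_mem' := fun c a ha => c.2 a ha }
  obtain ⟨X, rfl⟩ := hfg
  obtain ⟨t, ht, htN⟩ := Submodule.exists_sub_one_mem_and_smul_eq_zero_of_fg_of_le_smul I
    (Submodule.span S (X : Set K)) ⟨X, rfl⟩ (by
      refine Submodule.span_le.2 fun x hx => ?_
      refine Submodule.mul_induction_on (h (Submodule.subset_span hx)) (fun e he y hy => ?_)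
        fun _ _ => Submodule.add_mem _
      have hy' : y ∈ Submodule.span S (X : Set K) := by
        rw [← Submodule.span_span_of_tower R S]
        exact Submodule.subset_span hy
      exact Submodule.smul_mem_smul (I := I) (r := ⟨e, hES e he⟩) he hy')
  obtain ⟨x, hx, hx0⟩ : ∃ x ∈ (X : Set K), x ≠ 0 := by
    by_contra! hX
    exact hH (Submodule.span_eq_bot.2 hX)
  have ht0 : (t : K) = 0 := by
    have : (t : K) * x = 0 := htN x (Submodule.subset_span hx)
    exact (mul_eq_zero.1 this).resolve_right hx0
  have h1 : (t : K) - 1 ∈ E := ht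
  rw [ht0, zero_sub] at h1
  simpa using E.neg_mem h1

/-- If multiplication by `b` maps a nonzero finitely generated module `H` into `E * H`, with `E`
multiplicatively closed, then some power of `b` lies in `E`. -/
theorem Submodule.exists_pow_mem_of_smul_le_mul {E H : Submodule R K} (hE : E * E ≤ E)
    (hH : H ≠ ⊥) (hfg : H.FG) {b : R} (h : algebraMap R K b • H ≤ E * H) :
    ∃ n : ℕ, algebraMap R K b ^ n ∈ E := by
  by_cases ha : algebraMap R K b = 0
  · exact ⟨1, by simp [ha]⟩
  have hpow : ∀ (m : ℕ) {x : K}, x ∈ E → algebraMap R K b ^ m * x ∈ E := fun m x hx => by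
    rw [← map_pow, ← Algebra.smul_def]
    exact E.smul_mem _ hx
  let E' : Submodule R K :=
    { carrier := {x | ∃ n : ℕ, algebraMap R K b ^ n * x ∈ E}
      zero_mem' := ⟨0, by simp⟩
      add_mem' := by
        rintro x y ⟨m, hm⟩ ⟨n, hn⟩
        refine ⟨m + n, ?_⟩
        have := E.add_mem (hpow n hm) (hpow m hn)
        convert this using 1
        ring
      smul_mem' := by
        rintro c x ⟨n, hn⟩
        exact ⟨n, by simpa only [mul_smul_comm] using E.smul_mem c hn⟩ }
  have hE' : E' * E' ≤ E' := Submodule.mul_le.2 <| by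
    rintro x ⟨m, hm⟩ y ⟨n, hn⟩
    refine ⟨m + n, ?_⟩
    have := hE (Submodule.mul_mem_mul hm hn)
    convert this using 1
    ring
  obtain ⟨n, hn⟩ := Submodule.one_mem_of_fg_of_le_mul hE' hH hfg fun x hx => by
    have hmem : ∀ z ∈ E * H, (algebraMap R K b)⁻¹ * z ∈ E' * H := fun z hz => by
      refine Submodule.mul_induction_on hz (fun e he y hy => ?_) fun u v hu hv => ?_
      · rw [← mul_assoc]
        exact Submodule.mul_mem_mul ⟨1, by rwa [pow_one, mul_inv_cancel_left₀ ha]⟩ hy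
      · rw [mul_add]
        exact Submodule.add_mem _ hu hv
    simpa only [inv_mul_cancel_left₀ ha] using
      hmem _ (Submodule.smul_le_iff_forall_mul_mem.1 h x hx)
  exact ⟨n, by simpa using hn⟩

end PointwiseSubmodule

namespace SemistarOp

variable {R K : Type*} [CommRing R] [Field K] [Algebra R K] (s : SemistarOp R K)

theorem mul_star_le {F G : Submodule R K} (hF : F ≠ ⊥) (hG : G ≠ ⊥) :
    F * s.star G ≤ s.star (F * G) := by
  refine Submodule.mul_le.2 fun a ha z hz => ?_
  by_cases ha0 : a = 0
  · simp [ha0]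
  have h := s.star_mono (a • G) (F * G) (Submodule.smul_ne_bot ha0 hG) (mul_ne_zero hF hG)
    (Submodule.smul_le_iff_forall_mul_mem.2 fun y hy => Submodule.mul_mem_mul ha hy)
  rw [s.star_smul a ha0 G hG] at h
  exact h (Submodule.smul_mem_pointwise_smul z a _ hz)

theorem star_le {F G : Submodule R K} (hF : F ≠ ⊥) (hG : G ≠ ⊥) (h : F ≤ s.star G) :
    s.star F ≤ s.star G :=
  (s.star_mono F _ hF (s.star_ne_bot G hG) h).trans (s.star_star G hG).le

theorem star_mul_star_le {F G : Submodule R K} (hF : F ≠ ⊥) (hG : G ≠ ⊥) :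
    s.star F * s.star G ≤ s.star (F * G) := by
  refine (s.mul_star_le (s.star_ne_bot F hF) hG).trans
    (s.star_le (mul_ne_zero (s.star_ne_bot F hF) hG) (mul_ne_zero hF hG) ?_)
  rw [mul_comm, mul_comm F]
  exact s.mul_star_le hG hF

theorem one_mem_star_mul {F G : Submodule R K} (hF : F ≠ ⊥) (hG : G ≠ ⊥)
    (h1F : 1 ∈ s.star F) (h1G : 1 ∈ s.star G) : 1 ∈ s.star (F * G) := by
  simpa using s.star_mul_star_le hF hG (Submodule.mul_mem_mul h1F h1G)

theorem smul_star_le_self {F : Submodule R K} (hF : F ≠ ⊥) {a : K} (h : a • F ≤ s.star F) :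
    a • s.star F ≤ s.star F := by
  by_cases ha : a = 0
  · exact Submodule.smul_le_iff_forall_mul_mem.2 fun y _ => by simp [ha]
  rw [← s.star_smul a ha F hF]
  exact s.star_le (Submodule.smul_ne_bot ha hF) hF h

theorem smul_star_mul_le {F G : Submodule R K} (hF : F ≠ ⊥) (hG : G ≠ ⊥) {a : K}
    (h : a • s.star F ≤ s.star F) : a • s.star (F * G) ≤ s.star (F * G) := by
  refine s.smul_star_le_self (mul_ne_zero hF hG) ?_
  rw [← smul_mul_assoc]
  refine (mul_le_mul' (fun z hz => ?_) (s.le_star G hG)).trans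
    (s.star_mul_star_le hF hG)
  obtain ⟨y, hy, rfl⟩ := (Submodule.mem_smul_pointwise_iff_exists _ _ _).1 hz
  exact h (Submodule.smul_mem_pointwise_smul y a _ (s.le_star F hF hy))

/-- A semistar operation is of finite type if `F^*` is the union of the `J^*`, for `J` ranging
over the nonzero finitely generated submodules of `F`. -/
def IsFiniteType : Prop :=
  ∀ F : Submodule R K, F ≠ ⊥ →
    s.star F = ⨆ J ∈ {J : Submodule R K | J ≠ ⊥ ∧ J.FG ∧ J ≤ F}, s.star J

theorem IsFiniteType.exists_fg {s : SemistarOp R K} (hft : s.IsFiniteType) {F : Submodule R K}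
    (hF : F ≠ ⊥) {x : K} (hx : x ∈ s.star F) :
    ∃ J : Submodule R K, J ≠ ⊥ ∧ J.FG ∧ J ≤ F ∧ x ∈ s.star J := by
  rw [hft F hF, iSup_subtype'] at hx
  obtain ⟨y, hy, hy0⟩ := F.ne_bot_iff.1 hF
  have : Nonempty {J : Submodule R K | J ≠ ⊥ ∧ J.FG ∧ J ≤ F} :=
    ⟨⟨Submodule.span R {y}, by simpa using hy0, Submodule.fg_span_singleton y, by simpa using hy⟩⟩
  rw [Submodule.mem_iSup_of_directed] at hx
  · obtain ⟨⟨J, hJ, hJfg, hJF⟩, hxJ⟩ := hx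
    exact ⟨J, hJ, hJfg, hJF, hxJ⟩
  · rintro ⟨J, hJ, hJfg, hJF⟩ ⟨L, hL, hLfg, hLF⟩
    have hne : J ⊔ L ≠ ⊥ := fun h => hJ (sup_eq_bot_iff.1 h).1
    exact ⟨⟨J ⊔ L, hne, hJfg.sup hLfg, sup_le hJF hLF⟩,
      s.star_mono _ _ hJ hne le_sup_left, s.star_mono _ _ hL hne le_sup_right⟩

/-- A semistar operation is stable if it distributes over finite intersections. -/
def IsStable : Prop :=
  ∀ F G : Submodule R K, F ≠ ⊥ → G ≠ ⊥ → s.star (F ⊓ G) = s.star F ⊓ s.star G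

/-- The `*`-integral closure of `R` in `K`. -/
def integralClosure : Subalgebra R K where
  carrier := {x | ∃ J : Submodule R K, J ≠ ⊥ ∧ J.FG ∧ x • s.star J ≤ s.star J}
  mul_mem' := by
    rintro x y ⟨J, hJ, hJfg, hx⟩ ⟨L, hL, hLfg, hy⟩
    refine ⟨J * L, mul_ne_zero hJ hL, hJfg.mul hLfg, ?_⟩
    have h₁ := Submodule.smul_le_iff_forall_mul_mem.1 (s.smul_star_mul_le hJ hL hx)
    have h₂ := Submodule.smul_le_iff_forall_mul_mem.1 (s.smul_star_mul_le hL hJ hy)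
    rw [mul_comm L] at h₂
    refine Submodule.smul_le_iff_forall_mul_mem.2 fun z hz => ?_
    rw [mul_assoc]
    exact h₁ _ (h₂ z hz)
  add_mem' := by
    rintro x y ⟨J, hJ, hJfg, hx⟩ ⟨L, hL, hLfg, hy⟩
    refine ⟨J * L, mul_ne_zero hJ hL, hJfg.mul hLfg, ?_⟩
    have h₁ := Submodule.smul_le_iff_forall_mul_mem.1 (s.smul_star_mul_le hJ hL hx)
    have h₂ := Submodule.smul_le_iff_forall_mul_mem.1 (s.smul_star_mul_le hL hJ hy)
    rw [mul_comm L] at h₂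
    refine Submodule.smul_le_iff_forall_mul_mem.2 fun z hz => ?_
    rw [add_mul]
    exact Submodule.add_mem _ (h₁ z hz) (h₂ z hz)
  algebraMap_mem' r := by
    refine ⟨Submodule.span R {1}, by simp, Submodule.fg_span_singleton 1,
      Submodule.smul_le_iff_forall_mul_mem.2 fun z hz => ?_⟩
    rw [← Algebra.smul_def]
    exact Submodule.smul_mem _ r hz

variable {s} in
/-- The `*`-integral closure is `*`-closed. -/
theorem IsFiniteType.star_integralClosure (hft : s.IsFiniteType) :
    s.star (Subalgebra.toSubmodule s.integralClosure) =
      Subalgebra.toSubmodule s.integralClosure := by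
  have hD : Subalgebra.toSubmodule s.integralClosure ≠ ⊥ :=
    (Submodule.ne_bot_iff _).2 ⟨1, s.integralClosure.one_mem, one_ne_zero⟩
  have hcommon : ∀ J : Submodule R K, J.FG → J ≤ Subalgebra.toSubmodule s.integralClosure →
      ∃ L : Submodule R K, L ≠ ⊥ ∧ L.FG ∧ ∀ z ∈ J, z • s.star L ≤ s.star L := by
    intro J hfg hJD
    induction J, hfg using Submodule.fg_induction with
    | singleton x =>
      obtain ⟨L, hL, hLfg, hx⟩ := hJD (Submodule.mem_span_singleton_self x)
      refine ⟨L, hL, hLfg, fun z hz => Submodule.smul_le_iff_forall_mul_mem.2 fun y hy => ?_⟩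
      obtain ⟨r, rfl⟩ := Submodule.mem_span_singleton.1 hz
      rw [smul_mul_assoc]
      exact Submodule.smul_mem _ r (Submodule.smul_le_iff_forall_mul_mem.1 hx y hy)
    | sup J₁ J₂ _ _ ih₁ ih₂ =>
      obtain ⟨L₁, hL₁, hfg₁, h₁⟩ := ih₁ (le_sup_left.trans hJD)
      obtain ⟨L₂, hL₂, hfg₂, h₂⟩ := ih₂ (le_sup_right.trans hJD)
      refine ⟨L₁ * L₂, mul_ne_zero hL₁ hL₂, hfg₁.mul hfg₂, fun z hz =>
        Submodule.smul_le_iff_forall_mul_mem.2 fun y hy => ?_⟩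
      obtain ⟨z₁, hz₁, z₂, hz₂, rfl⟩ := Submodule.mem_sup.1 hz
      have hs₁ := s.smul_star_mul_le hL₁ hL₂ (h₁ z₁ hz₁)
      have hs₂ := s.smul_star_mul_le hL₂ hL₁ (h₂ z₂ hz₂)
      rw [mul_comm L₂] at hs₂
      rw [add_mul]
      exact Submodule.add_mem _ (Submodule.smul_le_iff_forall_mul_mem.1 hs₁ y hy)
        (Submodule.smul_le_iff_forall_mul_mem.1 hs₂ y hy)
  refine le_antisymm (fun z hz => ?_) (s.le_star _ hD)
  obtain ⟨J, hJ, hfg, hJD, hzJ⟩ := hft.exists_fg hD hz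
  obtain ⟨L, hL, hLfg, hJL⟩ := hcommon J hfg hJD
  refine ⟨L, hL, hLfg, Submodule.smul_le_iff_forall_mul_mem.2 fun y hy => ?_⟩
  have hmul : J * L ≤ s.star L := Submodule.mul_le.2 fun a ha b hb =>
    Submodule.smul_le_iff_forall_mul_mem.1 (hJL a ha) b (s.le_star L hL hb)
  exact s.star_le (mul_ne_zero hJ hL) hL hmul
    (s.star_mul_star_le hJ hL (Submodule.mul_mem_mul hzJ hy))

/-- If `D` is a `*`-closed overring and finitely generated `D`-modules have principal `*`-closure,
then any two elements of `D` have a greatest common divisor. -/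
theorem exists_gcd {D : Subalgebra R K}
    (hD : s.star (Subalgebra.toSubmodule D) = Subalgebra.toSubmodule D)
    (hprin : ∀ F : Submodule D K, F ≠ ⊥ → F.FG →
      ∃ x : K, s.star (Submodule.span R (F : Set K)) = x • Subalgebra.toSubmodule D)
    (a b : D) : ∃ g : D, g ∣ a ∧ g ∣ b ∧ ∀ c : D, c ∣ a → c ∣ b → c ∣ g := by
  by_cases hab : a = 0 ∧ b = 0
  · obtain ⟨rfl, rfl⟩ := hab
    exact ⟨0, dvd_rfl, dvd_rfl, fun c _ _ => dvd_zero c⟩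
  have hDne : Subalgebra.toSubmodule D ≠ ⊥ :=
    (Submodule.ne_bot_iff _).2 ⟨1, D.one_mem, one_ne_zero⟩
  set F := Submodule.span D {(a : K), (b : K)}
  have haF : (a : K) ∈ F := Submodule.subset_span (by simp)
  have hbF : (b : K) ∈ F := Submodule.subset_span (by simp)
  have hne : ∀ c : D, c ∣ a → c ∣ b → (c : K) ≠ 0 := fun c hca hcb hc => by
    obtain rfl : c = 0 := Subtype.ext hc
    exact hab ⟨zero_dvd_iff.1 hca, zero_dvd_iff.1 hcb⟩
  have hF : F ≠ ⊥ := fun h => hab <| by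
    rw [h, Submodule.mem_bot] at haF hbF
    exact ⟨Subtype.ext haF, Subtype.ext hbF⟩
  have hG : Submodule.span R (F : Set K) ≠ ⊥ := fun h =>
    hF (F.eq_bot_iff.2 fun z hz => Submodule.span_eq_bot.1 h z hz)
  have hle : ∀ c : D, c ∣ a → c ∣ b →
      s.star (Submodule.span R (F : Set K)) ≤ (c : K) • Subalgebra.toSubmodule D :=
    fun c hca hcb => by
      have hc := hne c hca hcb
      rw [← hD, ← s.star_smul _ hc _ hDne]
      refine s.star_mono _ _ hG (Submodule.smul_ne_bot hc hDne) (Submodule.span_le.2 fun z hz => ?_)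
      obtain ⟨u, v, rfl⟩ := Submodule.mem_span_pair.1 hz
      obtain ⟨d, rfl⟩ := hca
      obtain ⟨e, rfl⟩ := hcb
      refine (Submodule.mem_smul_pointwise_iff_exists _ _ _).2
        ⟨(u * d + v * e : D), (u * d + v * e : D).2, ?_⟩
      simp only [Subalgebra.smul_def, smul_eq_mul]
      push_cast
      ring
  obtain ⟨g, hg⟩ := hprin F hF (Submodule.fg_span (Set.toFinite _))
  have hgmem : g ∈ s.star (Submodule.span R (F : Set K)) := by
    rw [hg]
    simpa using Submodule.smul_mem_pointwise_smul 1 g (Subalgebra.toSubmodule D) D.one_mem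
  have hdvd : ∀ {c : D} {z : D}, (z : K) ∈ (c : K) • Subalgebra.toSubmodule D → c ∣ z := by
    intro c z hz
    obtain ⟨d, hd, hcd⟩ := (Submodule.mem_smul_pointwise_iff_exists _ _ _).1 hz
    exact ⟨⟨d, hd⟩, Subtype.ext hcd.symm⟩
  have hgD : g ∈ D := by
    obtain ⟨d, hd, hgd⟩ := (Submodule.mem_smul_pointwise_iff_exists _ _ _).1
      (hle 1 (one_dvd a) (one_dvd b) hgmem)
    rw [← hgd]
    simpa using hd
  have hFg : ∀ z ∈ F, z ∈ g • Subalgebra.toSubmodule D := fun z hz =>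
    hg ▸ s.le_star _ hG (Submodule.subset_span hz)
  exact ⟨⟨g, hgD⟩, hdvd (hFg _ haF), hdvd (hFg _ hbF), fun c hca hcb => hdvd (hle c hca hcb hgmem)⟩

variable [IsFractionRing R K]

variable {s} in
theorem IsStable.exists_mul_le_of_fg_le_star (hst : s.IsStable) {F H : Submodule R K}
    (hF : F ≠ ⊥) (hfg : H.FG) (h : H ≤ s.star F) :
    ∃ I : Submodule R K, I ≠ ⊥ ∧ I ≤ 1 ∧ 1 ∈ s.star I ∧ I * H ≤ F := by
  have one_ne_bot : (1 : Submodule R K) ≠ ⊥ := one_ne_zero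
  have one_mem : (1 : K) ∈ s.star (1 : Submodule R K) :=
    s.le_star 1 one_ne_bot (Submodule.one_le.1 le_rfl)
  induction H, hfg using Submodule.fg_induction with
  | singleton x =>
    by_cases hx : x = 0
    · exact ⟨1, one_ne_bot, le_rfl, one_mem, by simp [hx]⟩
    have hx' : x⁻¹ ≠ 0 := inv_ne_zero hx
    have hxF : x⁻¹ • F ≠ ⊥ := Submodule.smul_ne_bot hx' hF
    refine ⟨1 ⊓ x⁻¹ • F, Submodule.one_inf_ne_bot hxF, inf_le_left, ?_, ?_⟩
    · rw [hst _ _ one_ne_bot hxF, s.star_smul _ hx' F hF]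
      refine ⟨one_mem, (Submodule.mem_smul_pointwise_iff_exists _ _ _).2
        ⟨x, h (Submodule.mem_span_singleton_self x), inv_mul_cancel₀ hx⟩⟩
    · refine Submodule.mul_le.2 fun a ha y hy => ?_
      obtain ⟨r, rfl⟩ := Submodule.mem_span_singleton.1 hy
      obtain ⟨z, hz, rfl⟩ := (Submodule.mem_smul_pointwise_iff_exists _ _ _).1 ha.2
      rw [smul_eq_mul, mul_smul_comm, mul_right_comm, inv_mul_cancel₀ hx, one_mul]
      exact F.smul_mem r hz
  | sup N₁ N₂ _ _ ih₁ ih₂ =>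
    obtain ⟨I₁, hI₁, hle₁, h1₁, hmul₁⟩ := ih₁ (le_sup_left.trans h)
    obtain ⟨I₂, hI₂, hle₂, h1₂, hmul₂⟩ := ih₂ (le_sup_right.trans h)
    refine ⟨I₁ * I₂, mul_ne_zero hI₁ hI₂, ?_, s.one_mem_star_mul hI₁ hI₂ h1₁ h1₂, ?_⟩
    · simpa using mul_le_mul' hle₁ hle₂
    · rw [Submodule.mul_sup]
      refine sup_le ?_ ?_
      · rw [mul_assoc, mul_left_comm]
        simpa using mul_le_mul' hle₂ hmul₁
      · rw [mul_assoc]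
        simpa using mul_le_mul' hle₁ hmul₂

variable {s} in
/-- If `1 ∈ I^*` for an ideal `I` of `R` and every element of `I` has a power in a `*`-closed
submodule `E`, then `1 ∈ E`. -/
theorem IsFiniteType.one_mem_star_of_forall_exists_pow_mem (hft : s.IsFiniteType)
    {E I : Submodule R K} (hE : E ≠ ⊥) (hI : I ≠ ⊥) (hI1 : I ≤ 1) (h1 : 1 ∈ s.star I)
    (hpow : ∀ b : R, algebraMap R K b ∈ I → ∃ n : ℕ, algebraMap R K b ^ n ∈ E) :
    1 ∈ s.star E := by
  obtain ⟨J, hJ, hJfg, hJI, h1J⟩ := hft.exists_fg hI h1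
  let 𝔞 : Ideal R := E.comap (Algebra.linearMap R K)
  let 𝔟 : Ideal R := J.comap (Algebra.linearMap R K)
  have hmap : Submodule.map (Algebra.linearMap R K) 𝔟 = J := by
    refine Submodule.map_comap_eq_self fun x hx => ?_
    obtain ⟨b, hb⟩ := Submodule.mem_one.1 (hI1 (hJI hx))
    exact ⟨b, hb⟩
  have hfg : 𝔟.FG := Submodule.fg_of_fg_map_injective (Algebra.linearMap R K)
    (IsFractionRing.injective R K) (by rwa [hmap])
  obtain ⟨N, hN⟩ := Ideal.exists_pow_le_of_le_radical_of_fg (J := 𝔞) (fun b hb => by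
    obtain ⟨n, hn⟩ := hpow b (hJI hb)
    exact ⟨n, by simpa [𝔞] using hn⟩) hfg
  have hJpow : ∀ n : ℕ, J ^ n ≠ ⊥ ∧ 1 ∈ s.star (J ^ n) ∧
      J ^ n ≤ Submodule.map (Algebra.linearMap R K) (𝔟 ^ n) := fun n => by
    induction n with
    | zero =>
      have h0 : (1 : Submodule R K) ≠ ⊥ := one_ne_zero
      rw [pow_zero, pow_zero]
      exact ⟨h0, s.le_star 1 h0 (Submodule.one_le.1 le_rfl),
        Submodule.one_le.2 ⟨1, by simp⟩⟩
    | succ n ih =>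
      rw [pow_succ, pow_succ]
      refine ⟨mul_ne_zero ih.1 hJ, s.one_mem_star_mul ih.1 hJ ih.2.1 h1J,
        Submodule.mul_le.2 fun x hx y hy => ?_⟩
      obtain ⟨a, ha, rfl⟩ := ih.2.2 hx
      rw [← hmap] at hy
      obtain ⟨b, hb, rfl⟩ := hy
      exact ⟨a * b, Ideal.mul_mem_mul ha hb, by simp⟩
  exact s.star_mono _ _ (hJpow N).1 hE
    ((hJpow N).2.2.trans (Submodule.map_le_iff_le_comap.2 hN)) (hJpow N).2.1

variable {s} in
/-- If a finitely generated `H` is `*`-idempotent, then `H^*` is a ring containing `R`. -/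
theorem IsFiniteType.one_mem_star_of_fg (hft : s.IsFiniteType) (hst : s.IsStable)
    {H : Submodule R K} (hH : H ≠ ⊥) (hfg : H.FG) (hidem : s.star (H * H) = s.star H) :
    1 ∈ s.star H := by
  have hmul : s.star H * s.star H ≤ s.star H := (s.star_mul_star_le hH hH).trans hidem.le
  obtain ⟨I, hI, hI1, h1, hIH⟩ := hst.exists_mul_le_of_fg_le_star (mul_ne_zero hH hH) hfg
    ((s.le_star H hH).trans hidem.ge)
  rw [← s.star_star H hH]
  refine hft.one_mem_star_of_forall_exists_pow_mem (s.star_ne_bot H hH) hI hI1 h1 fun b hb =>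
    Submodule.exists_pow_mem_of_smul_le_mul hmul hH hfg ?_
  exact Submodule.smul_le_iff_forall_mul_mem.2 fun y hy =>
    mul_le_mul' (s.le_star H hH) le_rfl (hIH (Submodule.mul_mem_mul hb hy))

variable [IsDomain R]

variable {s} in
/-- In a Boole `*`-regular domain, `*`-closures of finitely generated modules are principal
over overrings. -/
theorem IsFiniteType.exists_star_eq_smul (hft : s.IsFiniteType) (hst : s.IsStable)
    (hboole : ∀ I : Submodule R K, IsFrac R K I →
      ∃ x : K, x ≠ 0 ∧ s.star (I * I) = x • s.star I)
    {J : Submodule R K} (hJ : J ≠ ⊥) (hfg : J.FG) :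
    ∃ x : K, x ≠ 0 ∧ ∃ E : Submodule R K, s.star J = x • E ∧ 1 ∈ E ∧ E * E ≤ E := by
  obtain ⟨x, hx, hxJ⟩ := hboole J (isFrac_of_fg hJ hfg)
  have hx' : x⁻¹ ≠ 0 := inv_ne_zero hx
  have hH : x⁻¹ • J ≠ ⊥ := Submodule.smul_ne_bot hx' hJ
  have hidem : s.star (x⁻¹ • J * x⁻¹ • J) = s.star (x⁻¹ • J) := by
    rw [smul_mul_assoc, mul_smul_comm, s.star_smul _ hx' _ (Submodule.smul_ne_bot hx'
      (mul_ne_zero hJ hJ)), s.star_smul _ hx' _ (mul_ne_zero hJ hJ), hxJ, smul_smul x⁻¹ x,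
      inv_mul_cancel₀ hx, one_smul, s.star_smul _ hx' J hJ]
  refine ⟨x, hx, s.star (x⁻¹ • J), ?_, hft.one_mem_star_of_fg hst hH (hfg.pointwise_smul _) hidem,
    (s.star_mul_star_le hH hH).trans hidem.le⟩
  rw [s.star_smul _ hx' J hJ, smul_smul, mul_inv_cancel₀ hx, one_smul]

variable {s} in
/-- In a Boole `*`-regular domain, the `*`-closure of a nonzero finitely generated module over the
`*`-integral closure is principal. -/
theorem IsFiniteType.exists_star_span_eq_smul (hft : s.IsFiniteType) (hst : s.IsStable)
    (hboole : ∀ I : Submodule R K, IsFrac R K I →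
      ∃ x : K, x ≠ 0 ∧ s.star (I * I) = x • s.star I)
    {F : Submodule s.integralClosure K} (hF : F ≠ ⊥) (hfg : F.FG) :
    ∃ x : K, s.star (Submodule.span R (F : Set K)) =
      x • Subalgebra.toSubmodule s.integralClosure := by
  obtain ⟨X, rfl⟩ := hfg
  set F := Submodule.span s.integralClosure (X : Set K)
  have hXF : (X : Set K) ⊆ F := Submodule.subset_span
  obtain ⟨y, hy, hy0⟩ : ∃ y ∈ (X : Set K), y ≠ 0 := by
    by_contra! hX
    exact hF (Submodule.span_eq_bot.2 hX)
  have hJ : Submodule.span R (X : Set K) ≠ ⊥ :=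
    (Submodule.ne_bot_iff _).2 ⟨y, Submodule.subset_span hy, hy0⟩
  have hG : Submodule.span R (F : Set K) ≠ ⊥ :=
    (Submodule.ne_bot_iff _).2 ⟨y, Submodule.subset_span (hXF hy), hy0⟩
  have hD : Subalgebra.toSubmodule s.integralClosure ≠ ⊥ :=
    (Submodule.ne_bot_iff _).2 ⟨1, s.integralClosure.one_mem, one_ne_zero⟩
  obtain ⟨x, hx, E, hE, h1, hEE⟩ := hft.exists_star_eq_smul hst hboole hJ ⟨X, rfl⟩
  have hED : E ≤ Subalgebra.toSubmodule s.integralClosure := fun e he => by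
    refine ⟨_, hJ, ⟨X, rfl⟩, ?_⟩
    rw [hE, smul_comm]
    refine Submodule.map_mono (Submodule.smul_le_iff_forall_mul_mem.2 fun z hz => ?_)
    exact hEE (Submodule.mul_mem_mul he hz)
  refine ⟨x, le_antisymm ?_ ?_⟩
  · rw [← hft.star_integralClosure, ← s.star_smul x hx _ hD]
    refine s.star_mono _ _ hG (Submodule.smul_ne_bot hx hD) (Submodule.span_le.2 fun z hz => ?_)
    induction hz using Submodule.span_induction with
    | mem z hz =>
      have h : z ∈ x • E := hE ▸ s.le_star _ hJ (Submodule.subset_span hz)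
      exact Submodule.map_mono hED h
    | zero => exact Submodule.zero_mem _
    | add u v _ _ hu hv => exact Submodule.add_mem _ hu hv
    | smul d z _ hz =>
      obtain ⟨w, hw, rfl⟩ := (Submodule.mem_smul_pointwise_iff_exists _ _ _).1 hz
      refine (Submodule.mem_smul_pointwise_iff_exists _ _ _).2
        ⟨d * w, s.integralClosure.mul_mem d.2 hw, ?_⟩
      rw [Subalgebra.smul_def, smul_eq_mul, smul_eq_mul, smul_eq_mul, mul_left_comm]
  · refine Submodule.smul_le_iff_forall_mul_mem.2 fun d hd => ?_
    have hxG : x ∈ s.star (Submodule.span R (F : Set K)) := by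
      refine s.star_mono _ _ hJ hG (Submodule.span_mono hXF) ?_
      rw [hE]
      simpa using Submodule.smul_mem_pointwise_smul _ x _ h1
    have hdG : d • Submodule.span R (F : Set K) ≤ Submodule.span R (F : Set K) := by
      refine Submodule.smul_le_iff_forall_mul_mem.2 fun z hz => ?_
      induction hz using Submodule.span_induction with
      | mem z hz => exact Submodule.subset_span (F.smul_mem ⟨d, hd⟩ hz)
      | zero => simp
      | add u v _ _ hu hv => simpa only [mul_add] using Submodule.add_mem _ hu hv
      | smul r z _ hz => simpa only [mul_smul_comm] using Submodule.smul_mem _ r hz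
    rw [mul_comm]
    exact Submodule.smul_le_iff_forall_mul_mem.1
      (s.smul_star_le_self hG (hdG.trans (s.le_star _ hG))) x hxG

end SemistarOp

/-- Let `*` be a semistar operation on `R` with `R^* = R` which is of
finite type and distributes over finite intersections (i.e. is spectral and of finite type).
If `R` is Boole `*`-regular, then the `*`-integral closure
`D = {x ∈ K : xJ^* ⊆ J^* for some nonzero finitely generated ideal J of R}` is a GCD-domain;
more precisely, `F^* = xD` for some `x ∈ K`, for every nonzero finitely generated
`D`-submodule `F` of `K`. -/
theorem star_integral_closure_is_gcd
    {R K : Type*} [CommRing R] [IsDomain R] [Field K] [Algebra R K] [IsFractionRing R K]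
    (s : SemistarOp R K) (hone : s.star (1 : Submodule R K) = 1)
    (hft : ∀ F : Submodule R K, F ≠ ⊥ →
      s.star F = ⨆ J ∈ {J : Submodule R K | J ≠ ⊥ ∧ J.FG ∧ J ≤ F}, s.star J)
    (hinter : ∀ F G : Submodule R K, F ≠ ⊥ → G ≠ ⊥ → s.star (F ⊓ G) = s.star F ⊓ s.star G)
    (hboole : ∀ I : Submodule R K, IsFrac R K I →
      ∃ x : K, x ≠ 0 ∧ s.star (I * I) = x • s.star I) :
    ∃ D : Subalgebra R K,
      (D : Set K) =
        {x : K | ∃ J : Submodule R K, J ≠ ⊥ ∧ J.FG ∧ ∀ y ∈ s.star J, x * y ∈ s.star J} ∧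
      (∀ a b : D, ∃ g : D, g ∣ a ∧ g ∣ b ∧ ∀ c : D, c ∣ a → c ∣ b → c ∣ g) ∧
      ∀ F : Submodule D K, F ≠ ⊥ → F.FG →
        ∃ x : K, s.star (Submodule.span R (F : Set K)) = x • Subalgebra.toSubmodule D := by
  have hft' : s.IsFiniteType := hft
  have hprin : ∀ F : Submodule s.integralClosure K, F ≠ ⊥ → F.FG →
      ∃ x : K, s.star (Submodule.span R (F : Set K)) =
        x • Subalgebra.toSubmodule s.integralClosure :=
    fun F hF hfg => hft'.exists_star_span_eq_smul hinter hboole hF hfg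
  refine ⟨s.integralClosure, ?_, s.exists_gcd hft'.star_integralClosure hprin, hprin⟩
  ext x
  exact exists_congr fun J => and_congr_right' (and_congr_right'
    Submodule.smul_le_iff_forall_mul_mem)
end

section
/- Let R be an integral domain and * a star operation on R that is spectral and of finite type (i.e. * is of finite type and (I ∩ J)^* = I^* ∩ J^* for all fractional ideals I, J). Then the following are equivalent: (i) R is integrally closed and Clifford *-regular; (ii) R is a Prüfer *-multiplication domain, i.e. (J(R : J))^* = R for every nonzero finitely generated ideal J of R, and R has *-finite character, i.e. every nonzero element of R lies in only finitely many *-maximal ideals. -/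
open scoped Pointwise

section Star

variable (R K : Type*) [CommRing R] [IsDomain R] [Field K] [Algebra R K] [IsFractionRing R K]

/-- A star operation on the domain `R` with quotient field `K`: a map on (nonzero)
fractional ideals satisfying `(aI)^* = aI^*`, `R^* = R`, `I ⊆ I^*`, monotonicity and
idempotency. -/
structure StarOperation : Type _ where
  star : Submodule R K → Submodule R K
  star_frac : ∀ I, IsFrac R K I → IsFrac R K (star I)
  star_smul : ∀ (a : K), a ≠ 0 → ∀ I, IsFrac R K I → star (a • I) = a • star I
  star_one : star (1 : Submodule R K) = 1
  le_star : ∀ I, IsFrac R K I → I ≤ star I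
  star_mono : ∀ I J, IsFrac R K I → IsFrac R K J → I ≤ J → star I ≤ star J
  star_star : ∀ I, IsFrac R K I → star (star I) = star I

variable {R K}

/-- `*` is of finite type: `I^* = ⋃ {J^* : J ⊆ I nonzero finitely generated}`. -/
def StarOperation.FiniteType (s : StarOperation R K) : Prop :=
  ∀ I, IsFrac R K I →
    s.star I = ⨆ J ∈ {J : Submodule R K | J ≠ ⊥ ∧ J.FG ∧ J ≤ I}, s.star J

/-- `I` is `*`-stable: with `E := (I^* : I^*)`, one has `(I^*(E : I^*))^* = E`. -/
def StarOperation.Stable (s : StarOperation R K) (I : Submodule R K) : Prop :=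
  s.star (s.star I * ((s.star I / s.star I) / s.star I)) = s.star I / s.star I

/-- `I` is Clifford `*`-regular: `I^* = (I²J)^*` for some nonzero ideal `J`. -/
def StarOperation.Regular (s : StarOperation R K) (I : Submodule R K) : Prop :=
  ∃ J : Submodule R K, IsFrac R K J ∧ s.star I = s.star (I * I * J)

/-- `I` is Boole `*`-regular: `(I²)^* = xI^*` for some nonzero `x ∈ K`. -/
def StarOperation.BooleRegular (s : StarOperation R K) (I : Submodule R K) : Prop :=
  ∃ x : K, x ≠ 0 ∧ s.star (I * I) = x • s.star I

/-- `I` is strongly `*`-stable: `I^* = xE` for some nonzero `x ∈ K`, where `E = (I^* : I^*)`. -/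
def StarOperation.StronglyStable (s : StarOperation R K) (I : Submodule R K) : Prop :=
  ∃ x : K, x ≠ 0 ∧ s.star I = x • (s.star I / s.star I)

end Star

/-- `M` is a `*`-maximal ideal of `R`: an integral `*`-ideal maximal among proper integral
`*`-ideals. -/
def StarOperation.MaxIdeal {R K : Type*} [CommRing R] [IsDomain R] [Field K] [Algebra R K]
    [IsFractionRing R K] (s : StarOperation R K) (M : Ideal R) : Prop :=
  M ≠ ⊤ ∧ s.star (idealK R K M) = idealK R K M ∧
    ∀ J : Ideal R, J ≠ ⊤ → s.star (idealK R K J) = idealK R K J → M ≤ J → J = M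

section FractionalIdeals

variable {R K : Type*} [CommRing R] [Field K] [Algebra R K]

theorem mem_idealK {I : Ideal R} {x : K} :
    x ∈ idealK R K I ↔ ∃ r ∈ I, algebraMap R K r = x := by
  simp [idealK]

theorem idealK_le_one (I : Ideal R) : idealK R K I ≤ 1 := by
  intro x hx
  obtain ⟨r, -, rfl⟩ := mem_idealK.1 hx
  exact Submodule.mem_one.2 ⟨r, rfl⟩

theorem idealK_mono {I J : Ideal R} (h : I ≤ J) : idealK R K I ≤ idealK R K J :=
  Submodule.map_mono h

theorem isFrac_iff {I : Submodule R K} : IsFrac R K I ↔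
    I ≠ ⊥ ∧ ∃ d : R, d ≠ 0 ∧ ∀ x ∈ I, d • x ∈ (1 : Submodule R K) := by
  simp only [IsFrac, Submodule.mem_one, Algebra.smul_def, eq_comm]

theorem IsFrac.of_le {I J : Submodule R K} (hJ : IsFrac R K J) (hI : I ≠ ⊥) (h : I ≤ J) :
    IsFrac R K I :=
  ⟨hI, hJ.2.imp fun _ hd => ⟨hd.1, fun x hx => hd.2 x (h hx)⟩⟩

/-- The localization `I R_M` of an `R`-submodule `I` of `K` at a prime ideal `M`. -/
def localizedAt (M : Ideal R) [hM : M.IsPrime] (I : Submodule R K) : Submodule R K where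
  carrier := {x | ∃ t ∉ M, t • x ∈ I}
  zero_mem' := ⟨1, fun h => hM.ne_top ((Ideal.eq_top_iff_one M).2 h), by simp⟩
  add_mem' := by
    rintro x y ⟨t, ht, hx⟩ ⟨u, hu, hy⟩
    refine ⟨t * u, fun h => (hM.mem_or_mem h).elim ht hu, ?_⟩
    rw [smul_add]
    refine I.add_mem ?_ ?_
    · rw [mul_comm, mul_smul]; exact I.smul_mem _ hx
    · rw [mul_smul]; exact I.smul_mem _ hy
  smul_mem' := by
    rintro r x ⟨t, ht, hx⟩
    exact ⟨t, ht, by rw [smul_comm]; exact I.smul_mem _ hx⟩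

section Localization

variable {M : Ideal R} [hM : M.IsPrime] {I J : Submodule R K} {x y : K}

theorem le_localizedAt : I ≤ localizedAt M I :=
  fun x hx => ⟨1, fun h => hM.ne_top ((Ideal.eq_top_iff_one M).2 h), by simpa using hx⟩

theorem localizedAt_mono (h : I ≤ J) : localizedAt M I ≤ localizedAt M J :=
  fun _ ⟨t, ht, hx⟩ => ⟨t, ht, h hx⟩

theorem localizedAt_localizedAt_le : localizedAt M (localizedAt M I) ≤ localizedAt M I := by
  rintro x ⟨t, ht, u, hu, hx⟩
  exact ⟨u * t, fun h => (hM.mem_or_mem h).elim hu ht, by rwa [mul_smul]⟩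

theorem mem_localizedAt_of_smul_mem {t : R} (ht : t ∉ M) (h : t • x ∈ localizedAt M I) :
    x ∈ localizedAt M I :=
  localizedAt_localizedAt_le ⟨t, ht, h⟩

theorem mul_mem_localizedAt_mul (hx : x ∈ localizedAt M I) (hy : y ∈ localizedAt M J) :
    x * y ∈ localizedAt M (I * J) := by
  obtain ⟨t, ht, hx⟩ := hx
  obtain ⟨u, hu, hy⟩ := hy
  exact ⟨t * u, fun h => (hM.mem_or_mem h).elim ht hu, by
    rw [← smul_mul_smul_comm]; exact Submodule.mul_mem_mul hx hy⟩

theorem mul_mem_localizedAt (hx : x ∈ localizedAt M (1 : Submodule R K))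
    (hy : y ∈ localizedAt M I) : x * y ∈ localizedAt M I := by
  simpa using mul_mem_localizedAt_mul hx hy

theorem one_mem_localizedAt_one : (1 : K) ∈ localizedAt M (1 : Submodule R K) :=
  le_localizedAt (Submodule.mem_one.2 ⟨1, map_one _⟩)

theorem exists_smul_mem_of_fg_of_le_localizedAt (hJ : J.FG) (h : J ≤ localizedAt M I) :
    ∃ t ∉ M, ∀ x ∈ J, t • x ∈ I := by
  induction J, hJ using Submodule.fg_induction with
  | singleton x =>
    obtain ⟨t, ht, hx⟩ := h (Submodule.mem_span_singleton_self x)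
    refine ⟨t, ht, fun y hy => ?_⟩
    obtain ⟨r, rfl⟩ := Submodule.mem_span_singleton.1 hy
    rw [smul_comm]; exact I.smul_mem _ hx
  | sup N₁ N₂ _ _ h₁ h₂ =>
    obtain ⟨t, ht, h₁⟩ := h₁ (le_sup_left.trans h)
    obtain ⟨u, hu, h₂⟩ := h₂ (le_sup_right.trans h)
    refine ⟨t * u, fun h => (hM.mem_or_mem h).elim ht hu, fun x hx => ?_⟩
    obtain ⟨y, hy, z, hz, rfl⟩ := Submodule.mem_sup.1 hx
    rw [smul_add]
    refine I.add_mem ?_ ?_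
    · rw [mul_comm, mul_smul]; exact I.smul_mem _ (h₁ y hy)
    · rw [mul_smul]; exact I.smul_mem _ (h₂ z hz)

theorem one_div_idealK_le_localizedAt {A : Ideal R} (h : ¬ A ≤ M) :
    1 / idealK R K A ≤ localizedAt M (1 : Submodule R K) := by
  intro z hz
  obtain ⟨a, ha, haM⟩ := Set.not_subset.1 h
  refine ⟨a, haM, ?_⟩
  rw [Algebra.smul_def, mul_comm]
  exact Submodule.mem_div_iff_forall_mul_mem.1 hz _ (mem_idealK.2 ⟨a, ha, rfl⟩)

theorem mul_one_div_le_one (J : Submodule R K) : J * (1 / J) ≤ 1 := by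
  refine Submodule.mul_le.2 fun y hy z hz => ?_
  rw [mul_comm]
  exact Submodule.mem_div_iff_forall_mul_mem.1 hz y hy

/-- If `1 ∈ (J (R : J)) R_M` then some product `y z` with `y ∈ J`, `z ∈ (R : J)` is a unit
of `R_M`. -/
theorem exists_mul_eq_of_one_mem_localizedAt [FaithfulSMul R K]
    (h : (1 : K) ∈ localizedAt M (J * (1 / J))) :
    ∃ y ∈ J, ∃ z ∈ 1 / J, ∃ r ∉ M, algebraMap R K r = y * z := by
  obtain ⟨t, ht, htm⟩ := h
  by_contra! hcon
  have h1 : J * (1 / J) ≤ idealK R K M := by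
    refine Submodule.mul_le.2 fun y hy z hz => ?_
    obtain ⟨r, hr⟩ := Submodule.mem_one.1 (mul_one_div_le_one J (Submodule.mul_mem_mul hy hz))
    by_cases hrM : r ∈ M
    · exact mem_idealK.2 ⟨r, hrM, hr⟩
    · exact absurd hr (hcon y hy z hz r hrM)
  obtain ⟨r, hr, hrt⟩ := mem_idealK.1 (h1 htm)
  rw [Algebra.smul_def, mul_one] at hrt
  exact ht (FaithfulSMul.algebraMap_injective R K hrt ▸ hr)

end Localization

theorem IsFrac.mul_one_div_ne_bot [FaithfulSMul R K] {I : Submodule R K}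
    (hI : IsFrac R K I) : I * (1 / I) ≠ ⊥ := by
  obtain ⟨hI0, d, hd, hdI⟩ := isFrac_iff.1 hI
  refine mul_ne_zero hI0 ((Submodule.ne_bot_iff _).2 ⟨algebraMap R K d, ?_, by simpa using hd⟩)
  refine Submodule.mem_div_iff_forall_mul_mem.2 fun y hy => ?_
  rw [← Algebra.smul_def]
  exact hdI y hy

/-- A finitely generated module `J` over a domain with `t J ⊆ M J`, `M` prime, has `t ∈ M`. -/
theorem Ideal.IsPrime.mem_of_smul_le {M : Ideal R} [FaithfulSMul R K] (hM : M.IsPrime)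
    {J : Submodule R K} (hJ0 : J ≠ ⊥) (hJ : J.FG) {t : R} (h : ∀ x ∈ J, t • x ∈ M • J) : t ∈ M := by
  have : Module.Finite R J := Module.Finite.iff_fg.2 hJ
  obtain ⟨p, hp, -, hcoeff, hpt⟩ :=
    LinearMap.exists_monic_and_natDegree_eq_and_coeff_mem_pow_and_aeval_eq_zero
      R (algebraMap R (Module.End R J) t) M (by
        rintro _ ⟨x, rfl⟩
        rw [Module.algebraMap_end_apply, Submodule.mem_smul_top_iff]
        exact h x x.2)
  obtain ⟨y, hy, hy0⟩ := J.ne_bot_iff.1 hJ0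
  have h0 : p.eval t = 0 := by
    rw [Polynomial.aeval_algebraMap_apply] at hpt
    have := congr_arg Subtype.val (LinearMap.congr_fun hpt ⟨y, hy⟩)
    simpa [hy0, Algebra.smul_def] using this
  rw [Polynomial.eval_eq_sum_range, Finset.sum_range_succ, hp.coeff_natDegree, one_mul] at h0
  refine hM.mem_of_pow_mem p.natDegree ?_
  rw [add_eq_zero_iff_neg_eq] at h0
  rw [← h0]
  refine M.neg_mem (M.sum_mem fun i hi => M.mul_mem_right _ ?_)
  exact Ideal.pow_le_self (Nat.sub_ne_zero_of_lt (Finset.mem_range.1 hi)) (hcoeff i)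

end FractionalIdeals

section IsFrac

variable {R K : Type*} [CommRing R] [IsDomain R] [Field K] [Algebra R K] {I J : Submodule R K}

theorem isFrac_one : IsFrac R K (1 : Submodule R K) :=
  isFrac_iff.2 ⟨one_ne_zero, 1, one_ne_zero, fun x hx => by simpa using hx⟩

theorem IsFrac.mul (hI : IsFrac R K I) (hJ : IsFrac R K J) : IsFrac R K (I * J) := by
  obtain ⟨hI0, d, hd, hdI⟩ := isFrac_iff.1 hI
  obtain ⟨hJ0, e, he, heJ⟩ := isFrac_iff.1 hJ
  refine isFrac_iff.2 ⟨mul_ne_zero hI0 hJ0, d * e, mul_ne_zero hd he, fun x hx => ?_⟩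
  have : I * J ≤ Submodule.comap (LinearMap.lsmul R K (d * e)) 1 := by
    refine Submodule.mul_le.2 fun y hy z hz => ?_
    have := Submodule.mul_mem_mul (hdI y hy) (heJ z hz)
    rw [mul_one, smul_mul_smul_comm] at this
    simpa using this
  exact this hx

variable [IsFractionRing R K]

theorem exists_algebraMap_mem_of_ne_bot (hI : I ≠ ⊥) :
    ∃ r : R, r ≠ 0 ∧ algebraMap R K r ∈ I := by
  obtain ⟨y, hy, hy0⟩ := I.ne_bot_iff.1 hI
  obtain ⟨a, b, hb, rfl⟩ := IsFractionRing.div_surjective (A := R) y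
  have hb0 := IsFractionRing.to_map_ne_zero_of_mem_nonZeroDivisors (K := K) hb
  refine ⟨a, ?_, ?_⟩
  · rintro rfl
    simp at hy0
  · have := I.smul_mem b hy
    rwa [Algebra.smul_def, mul_div_cancel₀ _ hb0] at this

theorem exists_smul_mem_one (x : K) : ∃ r : R, r ≠ 0 ∧ r • x ∈ (1 : Submodule R K) := by
  obtain ⟨a, b, hb, rfl⟩ := IsFractionRing.div_surjective (A := R) x
  have hb0 := IsFractionRing.to_map_ne_zero_of_mem_nonZeroDivisors (K := K) hb
  refine ⟨b, nonZeroDivisors.ne_zero hb, Submodule.mem_one.2 ⟨a, ?_⟩⟩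
  rw [Algebra.smul_def, mul_div_cancel₀ _ hb0]

theorem isFrac_idealK {A : Ideal R} (hA : A ≠ ⊥) : IsFrac R K (idealK R K A) := by
  refine isFrac_one.of_le ?_ (idealK_le_one A)
  obtain ⟨a, ha, ha0⟩ := A.ne_bot_iff.1 hA
  exact (Submodule.ne_bot_iff _).2 ⟨algebraMap R K a, mem_idealK.2 ⟨a, ha, rfl⟩, by simpa using ha0⟩

theorem IsFrac.inf (hI : IsFrac R K I) (hJ : IsFrac R K J) : IsFrac R K (I ⊓ J) := by
  refine hI.of_le ?_ inf_le_left
  obtain ⟨a, ha, haI⟩ := exists_algebraMap_mem_of_ne_bot hI.1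
  obtain ⟨b, hb, hbJ⟩ := exists_algebraMap_mem_of_ne_bot hJ.1
  refine (Submodule.ne_bot_iff _).2 ⟨algebraMap R K (a * b), ⟨?_, ?_⟩, by simp [ha, hb]⟩
  · rw [mul_comm, map_mul, ← Algebra.smul_def]; exact I.smul_mem _ haI
  · rw [map_mul, ← Algebra.smul_def]; exact J.smul_mem _ hbJ

theorem IsFrac.smul (hI : IsFrac R K I) {a : K} (ha : a ≠ 0) : IsFrac R K (a • I) := by
  obtain ⟨hI0, d, hd, hdI⟩ := isFrac_iff.1 hI
  obtain ⟨e, he, hea⟩ := exists_smul_mem_one (R := R) a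
  obtain ⟨y, hy, hy0⟩ := I.ne_bot_iff.1 hI0
  refine isFrac_iff.2 ⟨(Submodule.ne_bot_iff _).2 ⟨a * y, ?_, mul_ne_zero ha hy0⟩,
    e * d, mul_ne_zero he hd, ?_⟩
  · exact Submodule.smul_mem_pointwise_smul y a I hy
  · rintro x hx
    obtain ⟨z, hz, rfl⟩ := (Submodule.mem_smul_pointwise_iff_exists _ _ _).1 hx
    have := Submodule.mul_mem_mul hea (hdI z hz)
    rwa [mul_one, smul_mul_smul_comm] at this

theorem IsFrac.of_fg (hI : I ≠ ⊥) (h : I.FG) : IsFrac R K I := by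
  have : I.FG → ∃ d : R, d ≠ 0 ∧ ∀ x ∈ I, d • x ∈ (1 : Submodule R K) := fun h => by
    obtain ⟨t, ht, h⟩ := exists_smul_mem_of_fg_of_le_localizedAt (M := (⊥ : Ideal R)) h
      (I := (1 : Submodule R K)) fun x _ => exists_smul_mem_one x
    exact ⟨t, ht, h⟩
  exact isFrac_iff.2 ⟨hI, this h⟩

end IsFrac

namespace StarOperation

variable {R K : Type*} [CommRing R] [IsDomain R] [Field K] [Algebra R K]
  {s : StarOperation R K}

theorem star_le_one {I : Submodule R K} (hI : IsFrac R K I) (h : I ≤ 1) : s.star I ≤ 1 :=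
  (s.star_mono _ _ hI isFrac_one h).trans s.star_one.le

theorem star_eq_one_iff {I : Submodule R K} (hI : IsFrac R K I) (h : I ≤ 1) :
    s.star I = 1 ↔ (1 : K) ∈ s.star I := by
  refine ⟨fun h => h ▸ Submodule.mem_one.2 ⟨1, map_one _⟩, fun h1 => ?_⟩
  refine (star_le_one hI h).antisymm fun x hx => ?_
  obtain ⟨r, rfl⟩ := Submodule.mem_one.1 hx
  rw [← mul_one (algebraMap R K r), ← Algebra.smul_def]
  exact Submodule.smul_mem _ _ h1

variable [IsFractionRing R K]

theorem FiniteType.exists_fg_of_mem (hft : s.FiniteType) {I : Submodule R K} (hI : IsFrac R K I)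
    {x : K} (hx : x ∈ s.star I) : ∃ F : Submodule R K, F ≠ ⊥ ∧ F.FG ∧ F ≤ I ∧ x ∈ s.star F := by
  rw [hft I hI, ← sSup_image, Submodule.mem_sSup_of_directed] at hx
  · obtain ⟨_, ⟨F, hF, rfl⟩, hx⟩ := hx
    exact ⟨F, hF.1, hF.2.1, hF.2.2, hx⟩
  · obtain ⟨y, hy, hy0⟩ := I.ne_bot_iff.1 hI.1
    exact ⟨_, _, ⟨by simpa using hy0, Submodule.fg_span_singleton y, by simpa using hy⟩, rfl⟩
  · rintro _ ⟨F, hF, rfl⟩ _ ⟨G, hG, rfl⟩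
    have hFG : F ⊔ G ≠ ⊥ := fun h => hF.1 (sup_eq_bot_iff.1 h).1
    have h := IsFrac.of_fg hFG (hF.2.1.sup hG.2.1)
    exact ⟨_, ⟨F ⊔ G, ⟨hFG, hF.2.1.sup hG.2.1, sup_le hF.2.2 hG.2.2⟩, rfl⟩,
      s.star_mono _ _ (h.of_le hF.1 le_sup_left) h le_sup_left,
      s.star_mono _ _ (h.of_le hG.1 le_sup_right) h le_sup_right⟩

theorem FiniteType.exists_le_maxIdeal (hft : s.FiniteType) {A : Ideal R} (hA : A ≠ ⊥)
    (h : (1 : K) ∉ s.star (idealK R K A)) : ∃ M, s.MaxIdeal M ∧ A ≤ M := by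
  obtain ⟨M, hAM, hM⟩ := zorn_le_nonempty₀ {B : Ideal R | B ≠ ⊥ ∧ (1 : K) ∉ s.star (idealK R K B)}
    (fun c hc hchain B hB => by
      have hle : ∀ D ∈ c, D ≤ sSup c := fun D hD => le_sSup hD
      have h0 : sSup c ≠ ⊥ := ne_bot_of_le_ne_bot (hc hB).1 (hle B hB)
      refine ⟨sSup c, ⟨h0, fun h1 => ?_⟩, hle⟩
      obtain ⟨F, hF0, hF, hFc, h1⟩ := hft.exists_fg_of_mem (isFrac_idealK h0) h1
      have hsup : idealK R K (sSup c) = sSup (idealK R K '' c) := by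
        rw [sSup_image, idealK, sSup_eq_iSup, Submodule.map_iSup]
        simp_rw [Submodule.map_iSup]
        rfl
      rw [hsup] at hFc
      obtain ⟨_, ⟨D, hD, rfl⟩, hFD⟩ :=
        (CompleteLattice.isCompactElement_iff_le_of_directed_sSup_le _ _).1
          ((Submodule.fg_iff_compact F).1 hF) (idealK R K '' c) ⟨_, B, hB, rfl⟩
          (by
            rintro _ ⟨D, hD, rfl⟩ _ ⟨E, hE, rfl⟩
            rcases hchain.total hD hE with h | h
            · exact ⟨_, ⟨E, hE, rfl⟩, idealK_mono h, le_rfl⟩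
            · exact ⟨_, ⟨D, hD, rfl⟩, le_rfl, idealK_mono h⟩) hFc
      have hDf := isFrac_idealK (K := K) (hc hD).1
      exact (hc hD).2 (s.star_mono _ _ (hDf.of_le hF0 hFD) hDf hFD h1))
    A ⟨hA, h⟩
  have hMf := isFrac_idealK (K := K) hM.prop.1
  have h1M : (1 : K) ∉ s.star (idealK R K M) := hM.prop.2
  refine ⟨M, ⟨fun htop => h1M (s.le_star _ hMf (mem_idealK.2 ⟨1, htop ▸ trivial, map_one _⟩)),
    le_antisymm (fun x hx => ?_) (s.le_star _ hMf), fun J hJ hJs hMJ => ?_⟩, hAM⟩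
  · obtain ⟨r, rfl⟩ := Submodule.mem_one.1 (star_le_one hMf (idealK_le_one M) hx)
    let C : Ideal R := (s.star (idealK R K M)).comap (Algebra.linearMap R K)
    have hMC : M ≤ C := fun m hm => s.le_star _ hMf (mem_idealK.2 ⟨m, hm, rfl⟩)
    have hC0 : C ≠ ⊥ := ne_bot_of_le_ne_bot hM.prop.1 hMC
    have hCle : idealK R K C ≤ s.star (idealK R K M) := Submodule.map_comap_le _ _
    have hC : C ∈ {B : Ideal R | B ≠ ⊥ ∧ (1 : K) ∉ s.star (idealK R K B)} := by
      refine ⟨hC0, fun h1 => h1M ?_⟩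
      rw [← s.star_star _ hMf]
      exact s.star_mono _ _ (isFrac_idealK hC0) (s.star_frac _ hMf) hCle h1
    exact mem_idealK.2 ⟨r, hM.le_of_ge hC hMC hx, rfl⟩
  · refine le_antisymm (hM.le_of_ge ⟨ne_bot_of_le_ne_bot hM.prop.1 hMJ, fun h1 => ?_⟩ hMJ) hMJ
    rw [hJs] at h1
    obtain ⟨r, hr, hr1⟩ := mem_idealK.1 h1
    rw [← map_one (algebraMap R K)] at hr1
    exact hJ ((Ideal.eq_top_iff_one J).2 (IsFractionRing.injective R K hr1 ▸ hr))

theorem MaxIdeal.one_notMem {M : Ideal R} (hM : s.MaxIdeal M) : (1 : R) ∉ M :=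
  fun h => hM.1 ((Ideal.eq_top_iff_one M).2 h)

theorem MaxIdeal.one_notMem_star {M : Ideal R} (hM : s.MaxIdeal M) :
    (1 : K) ∉ s.star (idealK R K M) := fun h => by
  rw [hM.2.1] at h
  obtain ⟨r, hr, hr1⟩ := mem_idealK.1 h
  rw [← map_one (algebraMap R K)] at hr1
  exact hM.one_notMem (IsFractionRing.injective R K hr1 ▸ hr)

theorem MaxIdeal.isPrime {M : Ideal R} (hM : s.MaxIdeal M) : M.IsPrime := by
  by_cases hM0 : M = ⊥
  · subst hM0; exact Ideal.isPrime_bot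
  have hMf := isFrac_idealK (K := K) hM0
  refine ⟨hM.1, fun {a b} hab => or_iff_not_imp_right.2 fun hb => ?_⟩
  by_cases ha0 : a = 0
  · exact ha0 ▸ M.zero_mem
  have haK : algebraMap R K a ≠ 0 := by simpa using ha0
  let C : Ideal R := Submodule.comap (LinearMap.mulLeft R a) M
  have hMC : M ≤ C := fun m hm => M.mul_mem_left a hm
  have hbC : b ∈ C := hab
  have hC0 : C ≠ ⊥ := ne_bot_of_le_ne_bot hM0 hMC
  have hCf := isFrac_idealK (K := K) hC0
  have hCs : s.star (idealK R K C) = idealK R K C := by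
    refine le_antisymm (fun x hx => ?_) (s.le_star _ hCf)
    obtain ⟨r, rfl⟩ := Submodule.mem_one.1 (star_le_one hCf (idealK_le_one C) hx)
    have h1 : algebraMap R K a • idealK R K C ≤ idealK R K M := by
      intro y hy
      obtain ⟨z, hz, rfl⟩ := (Submodule.mem_smul_pointwise_iff_exists _ _ _).1 hy
      obtain ⟨c, hc, rfl⟩ := mem_idealK.1 hz
      exact mem_idealK.2 ⟨a * c, hc, by simp⟩
    have h2 := s.star_mono _ _ (hCf.smul haK) hMf h1
    rw [s.star_smul _ haK _ hCf, hM.2.1] at h2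
    obtain ⟨m, hm, hmr⟩ := mem_idealK.1 (h2 (Submodule.smul_mem_pointwise_smul _ _ _ hx))
    rw [smul_eq_mul, ← map_mul] at hmr
    refine mem_idealK.2 ⟨r, ?_, rfl⟩
    have := IsFractionRing.injective R K hmr
    exact show a * r ∈ M from this ▸ hm
  by_contra ha
  have hCtop : C ≠ ⊤ := fun h => ha (by
    have : (1 : R) ∈ C := h ▸ trivial
    simpa [C] using this)
  exact hb (hM.2.2 C hCtop hCs hMC ▸ hbC)

/-- For a spectral star operation of finite type, `I^*` is the intersection of the localizations
of `I` at the `*`-maximal ideals. -/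
theorem mem_star_iff (hft : s.FiniteType)
    (hinter : ∀ I J : Submodule R K, IsFrac R K I → IsFrac R K J →
      s.star (I ⊓ J) = s.star I ⊓ s.star J) {I : Submodule R K} (hI : IsFrac R K I) {x : K} :
    x ∈ s.star I ↔ ∀ M (hM : s.MaxIdeal M), haveI := hM.isPrime; x ∈ localizedAt M I := by
  by_cases hx0 : x = 0
  · simp [hx0]
  have hxI := hI.smul (inv_ne_zero hx0)
  have hC := isFrac_one.inf hxI
  have hmem : ∀ t : R, algebraMap R K t ∈ 1 ⊓ x⁻¹ • I ↔ t • x ∈ I := fun t => by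
    rw [Submodule.mem_inf, and_iff_right (Submodule.mem_one.2 ⟨t, rfl⟩),
      Submodule.mem_smul_pointwise_iff_exists, Algebra.smul_def]
    constructor
    · rintro ⟨b, hb, h⟩
      rwa [← h, smul_eq_mul, mul_comm, mul_inv_cancel_left₀ hx0]
    · exact fun h => ⟨_, h, by rw [smul_eq_mul]; field_simp⟩
  have hstar : x ∈ s.star I ↔ (1 : K) ∈ s.star (1 ⊓ x⁻¹ • I) := by
    rw [hinter _ _ isFrac_one hxI, s.star_one, s.star_smul _ (inv_ne_zero hx0) _ hI,
      Submodule.mem_inf, and_iff_right (Submodule.mem_one.2 ⟨1, map_one _⟩),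
      Submodule.mem_smul_pointwise_iff_exists]
    constructor
    · exact fun h => ⟨x, h, inv_mul_cancel₀ hx0⟩
    · rintro ⟨b, hb, h⟩
      rw [smul_eq_mul, inv_mul_eq_one₀ hx0] at h
      exact h ▸ hb
  rw [hstar]
  constructor
  · intro h1 M hM
    by_contra hcon
    have hle : 1 ⊓ x⁻¹ • I ≤ idealK R K M := by
      intro y hy
      obtain ⟨r, rfl⟩ := Submodule.mem_one.1 hy.1
      by_contra hr
      exact hcon ⟨r, fun h => hr (mem_idealK.2 ⟨r, h, rfl⟩), (hmem r).1 hy⟩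
    have hM0 : M ≠ ⊥ := by
      rintro rfl
      exact hC.1 (by simpa [idealK] using hle)
    exact hM.one_notMem_star (s.star_mono _ _ hC (isFrac_idealK hM0) hle h1)
  · intro h
    by_contra h1
    let C : Ideal R := (1 ⊓ x⁻¹ • I).comap (Algebra.linearMap R K)
    have hCK : idealK R K C = 1 ⊓ x⁻¹ • I := by
      refine (Submodule.map_comap_le _ _).antisymm fun y hy => ?_
      obtain ⟨r, rfl⟩ := Submodule.mem_one.1 hy.1
      exact mem_idealK.2 ⟨r, hy, rfl⟩
    have hC0 : C ≠ ⊥ := fun h => hC.1 (by rw [← hCK, h]; simp [idealK])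
    rw [← hCK] at h1
    obtain ⟨M, hM, hCM⟩ := hft.exists_le_maxIdeal hC0 h1
    obtain ⟨t, ht, htx⟩ := h M hM
    exact ht (hCM ((hmem t).2 htx))

end StarOperation

section Valuation

variable {R K : Type*} [CommRing R] [Field K] [Algebra R K] {I : Submodule R K}

/-- `R_M` is a valuation domain with quotient field `K`. -/
def IsValuationAt (K : Type*) [Field K] [Algebra R K] (M : Ideal R) [M.IsPrime] : Prop :=
  ∀ x : K, x ∈ localizedAt M (1 : Submodule R K) ∨ x⁻¹ ∈ localizedAt M (1 : Submodule R K)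

theorem isValuationAt_of_one_mem_localizedAt [FaithfulSMul R K] {M : Ideal R} [hM : M.IsPrime]
    (h : ∀ x : K, (1 : K) ∈ localizedAt M
      (Submodule.span R {1, x} * (1 / Submodule.span R {1, x}))) : IsValuationAt K M := by
  intro x
  obtain ⟨y, hy, z, hz, r, hr, hrz⟩ := exists_mul_eq_of_one_mem_localizedAt (h x)
  rw [Submodule.mem_div_iff_forall_mul_mem] at hz
  obtain ⟨p, hp⟩ := Submodule.mem_one.1 (hz 1 (Submodule.subset_span (by simp)))
  obtain ⟨q, hq⟩ := Submodule.mem_one.1 (hz x (Submodule.subset_span (by simp)))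
  rw [mul_one] at hp
  obtain ⟨a, b, rfl⟩ := Submodule.mem_span_pair.1 hy
  have hrpq : r = a * p + b * q := FaithfulSMul.algebraMap_injective R K (by
    rw [hrz, map_add, map_mul, map_mul, hp, hq, Algebra.smul_def, Algebra.smul_def]; ring)
  by_cases hpM : p ∈ M
  · right
    have hqM : q ∉ M := fun hqM =>
      hr (hrpq ▸ M.add_mem (M.mul_mem_left _ hpM) (M.mul_mem_left _ hqM))
    refine ⟨q, hqM, Submodule.mem_one.2 ⟨p, ?_⟩⟩
    have hx : x ≠ 0 := by
      rintro rfl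
      rw [mul_zero, ← map_zero (algebraMap R K)] at hq
      exact hqM (FaithfulSMul.algebraMap_injective R K hq ▸ M.zero_mem)
    rw [Algebra.smul_def, hp, hq, mul_inv_cancel_right₀ hx]
  · exact Or.inl ⟨p, hpM, Submodule.mem_one.2 ⟨q, by rw [Algebra.smul_def, hp, hq]⟩⟩

variable {M N : Ideal R} [hM : M.IsPrime] [hN : N.IsPrime]

theorem IsValuationAt.div_mem (hV : IsValuationAt K M) {e y : K} (he : e ∈ localizedAt M I)
    (hy : y ∉ localizedAt M I) : e / y ∈ localizedAt M (1 : Submodule R K) := by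
  by_cases he0 : e = 0
  · simp [he0]
  refine (hV (e / y)).resolve_right fun h => hy ?_
  rw [inv_div] at h
  have := mul_mem_localizedAt h he
  rwa [div_mul_cancel₀ _ he0] at this

theorem IsValuationAt.mem_or_mem_of_mul_mem (hV : IsValuationAt K M) {x y : K}
    (h : x * y ∈ localizedAt M (1 : Submodule R K)) :
    x ∈ localizedAt M (1 : Submodule R K) ∨ y ∈ localizedAt M (1 : Submodule R K) := by
  by_cases hy0 : y = 0
  · simp [hy0]
  refine (hV y).symm.imp_left fun hy => ?_
  have := mul_mem_localizedAt h hy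
  rwa [mul_inv_cancel_right₀ hy0] at this

/-- Every element `x` of an ideal `I` of a valuation domain satisfies `x I² ⊆ a b I` for some
`a, b ∈ I`. -/
theorem IsValuationAt.exists_mul_div_mem (hV : IsValuationAt K M) {x : K} (hx : x ∈ I)
    (hx0 : x ≠ 0) :
    ∃ a ∈ I, ∃ b ∈ I, a ≠ 0 ∧ b ≠ 0 ∧
      ∀ c ∈ I, ∀ d ∈ I, x / (a * b) * c * d ∈ localizedAt M I := by
  by_cases h : ∀ c ∈ I, ∀ d ∈ I, c * d / x ∈ localizedAt M I
  · refine ⟨x, hx, x, hx, hx0, hx0, fun c hc d hd => ?_⟩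
    convert h c hc d hd using 1
    field_simp
  · push Not at h
    obtain ⟨a, ha, b, hb, hab⟩ := h
    have ha0 : a ≠ 0 := by rintro rfl; simp at hab
    have hb0 : b ≠ 0 := by rintro rfl; simp at hab
    refine ⟨a, ha, b, hb, ha0, hb0, fun c hc d hd => ?_⟩
    have := mul_mem_localizedAt (hV.div_mem (le_localizedAt hc) hab) (le_localizedAt (M := M) hd)
    convert this using 1
    field_simp

/-- If `u I² ⊆ I R_M` and `R_N` is a valuation domain then `t u I² ⊆ I R_N` for some
`t ∉ M`. -/
theorem IsValuationAt.exists_smul_mul_mem [FaithfulSMul R K] (hV : IsValuationAt K N) {u : K}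
    (hu : ∀ c ∈ I, ∀ d ∈ I, u * c * d ∈ localizedAt M I) :
    ∃ t ∉ M, ∀ c ∈ I, ∀ d ∈ I, t • (u * c * d) ∈ localizedAt N I := by
  by_contra! hcon
  have hne : ∀ t ∉ M, algebraMap R K t ≠ 0 := fun t ht h => ht (by
    rw [(FaithfulSMul.algebraMap_eq_zero_iff R K).1 h]; exact M.zero_mem)
  have key : ∀ p ∈ I, ∀ t ∉ M, p / algebraMap R K t ∈ localizedAt N I := by
    intro p hp t ht
    obtain ⟨t', ht', hp'⟩ := hu p hp p hp
    obtain ⟨c, hc, d, hd, hcd⟩ := hcon (t' * t * t) fun h =>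
      (hM.mem_or_mem h).elim (fun h => (hM.mem_or_mem h).elim ht' ht) ht
    have ht0 := hne t ht
    have ht'0 := hne t' ht'
    have hu0 : u ≠ 0 := by rintro rfl; simp at hcd
    have hc0 : c ≠ 0 := by rintro rfl; simp at hcd
    have hd0 : d ≠ 0 := by rintro rfl; simp at hcd
    have h1 := hV.div_mem (le_localizedAt hp') hcd
    have h2 : t' • (u * p * p) / (t' * t * t) • (u * c * d) =
        p / (algebraMap R K t * c) * (p / (algebraMap R K t * d)) := by
      simp only [Algebra.smul_def, map_mul]
      field_simp
    rw [h2] at h1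
    rcases hV.mem_or_mem_of_mul_mem h1 with h | h
    · have := mul_mem_localizedAt h (le_localizedAt (M := N) hc)
      convert this using 1
      field_simp
    · have := mul_mem_localizedAt h (le_localizedAt (M := N) hd)
      convert this using 1
      field_simp
  obtain ⟨c, hc, d, hd, hcd⟩ := hcon 1 fun h => hM.ne_top ((Ideal.eq_top_iff_one M).2 h)
  obtain ⟨t, ht, h⟩ := hu c hc d hd
  refine hcd ?_
  have := key _ h t ht
  rwa [Algebra.smul_def, mul_div_cancel_left₀ _ (hne t ht), ← one_smul R (u * c * d)] at this

end Valuation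

namespace StarOperation

variable {R K : Type*} [CommRing R] [IsDomain R] [Field K] [Algebra R K] [IsFractionRing R K]
  {s : StarOperation R K}

theorem exists_algebraMap_eq_of_isIntegral
    (hinv : ∀ J : Submodule R K, J ≠ ⊥ → J.FG → s.star (J * (1 / J)) = 1) {x : K}
    (hx : IsIntegral R x) : ∃ r : R, algebraMap R K r = x := by
  rw [← Submodule.mem_one]
  by_cases hx0 : x = 0
  · simp [hx0]
  set J : Submodule R K := Subalgebra.toSubmodule (Algebra.adjoin R {x}) with hJdef
  have hJ0 : J ≠ ⊥ := (Submodule.ne_bot_iff _).2 ⟨1, one_mem (Algebra.adjoin R {x}), one_ne_zero⟩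
  have hJ := hinv J hJ0 hx.fg_adjoin_singleton
  have hfrac := isFrac_one.of_le
    (IsFrac.of_fg hJ0 hx.fg_adjoin_singleton).mul_one_div_ne_bot (mul_one_div_le_one J)
  have hle : x • (J * (1 / J)) ≤ J * (1 / J) := by
    intro y hy
    obtain ⟨z, hz, rfl⟩ := (Submodule.mem_smul_pointwise_iff_exists _ _ _).1 hy
    have hxJ : x * z ∈ J * (J * (1 / J)) :=
      Submodule.mul_mem_mul (Algebra.self_mem_adjoin_singleton R x) hz
    rwa [← mul_assoc, (Subalgebra.isIdempotentElem_toSubmodule _).eq] at hxJ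
  have := s.star_mono _ _ (hfrac.smul hx0) hfrac hle
  rw [s.star_smul _ hx0 _ hfrac, hJ] at this
  exact this ((Submodule.mem_smul_pointwise_iff_exists _ _ _).2
    ⟨1, Submodule.mem_one.2 ⟨1, map_one _⟩, by simp⟩)

theorem regular_of_isValuationAt (hft : s.FiniteType)
    (hinter : ∀ I J : Submodule R K, IsFrac R K I → IsFrac R K J →
      s.star (I ⊓ J) = s.star I ⊓ s.star J)
    (hval : ∀ M (hM : s.MaxIdeal M), haveI := hM.isPrime; IsValuationAt K M)
    (hfin : ∀ r : R, r ≠ 0 → {M : Ideal R | s.MaxIdeal M ∧ r ∈ M}.Finite)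
    {I : Submodule R K} (hI : IsFrac R K I) : s.Regular I := by
  set J : Submodule R K := s.star I / I / I with hJdef
  have hmemJ : ∀ x, x ∈ J ↔ ∀ c ∈ I, ∀ d ∈ I, x * c * d ∈ s.star I := fun x => by
    simp only [hJdef, Submodule.mem_div_iff_forall_mul_mem]
  obtain ⟨hI0, d, hd, hdI⟩ := isFrac_iff.1 hI
  obtain ⟨y, hy, hyI⟩ := exists_algebraMap_mem_of_ne_bot hI0
  have hyK : algebraMap R K y ≠ 0 := by simpa using hy
  have hJ : IsFrac R K J := by
    refine ((s.star_frac _ hI).smul (inv_ne_zero (mul_ne_zero hyK hyK))).of_le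
      ((Submodule.ne_bot_iff _).2 ⟨algebraMap R K d, (hmemJ _).2 fun c hc e he => ?_,
        by simpa using hd⟩) fun x hx => ?_
    · obtain ⟨r, hr⟩ := Submodule.mem_one.1 (hdI c hc)
      rw [← Algebra.smul_def, ← hr, ← Algebra.smul_def]
      exact Submodule.smul_mem _ _ (s.le_star _ hI he)
    · refine (Submodule.mem_smul_pointwise_iff_exists _ _ _).2
        ⟨_, (hmemJ x).1 hx _ hyI _ hyI, ?_⟩
      rw [smul_eq_mul]
      field_simp
  have hIIJ := (hI.mul hI).mul hJ
  refine ⟨J, hJ, le_antisymm ?_ ?_⟩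
  · rw [← s.star_star _ hIIJ]
    refine s.star_mono _ _ hI (s.star_frac _ hIIJ) fun x hx => (mem_star_iff hft hinter hIIJ).2 ?_
    intro M hM
    have := hM.isPrime
    by_cases hx0 : x = 0
    · rw [hx0]; exact Submodule.zero_mem _
    obtain ⟨a, ha, b, hb, ha0, hb0, hab⟩ := (hval M hM).exists_mul_div_mem hx hx0
    set u := x / (a * b) with hu
    obtain ⟨m, hm, hmu⟩ := exists_smul_mem_one (R := R) u
    have hbad := hfin (d * y * m) (mul_ne_zero (mul_ne_zero hd hy) hm)
    have hloc : ∀ N (hN : s.MaxIdeal N), haveI := hN.isPrime; ∃ t ∉ M,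
        ∀ c ∈ I, ∀ e ∈ I, t • (u * c * e) ∈ localizedAt N I := fun N hN => by
      have := hN.isPrime
      exact (hval N hN).exists_smul_mul_mem hab
    choose! t htM ht using hloc
    have hTM : ∏ N ∈ hbad.toFinset, t N ∉ M := by
      rw [Ideal.IsPrime.prod_mem_iff]
      rintro ⟨N, hN, h⟩
      exact htM N ((Set.Finite.mem_toFinset hbad).1 hN).1 h
    set T := ∏ N ∈ hbad.toFinset, t N with hT
    have hTu : T • u ∈ J := by
      refine (hmemJ _).2 fun c hc e he => (mem_star_iff hft hinter hI).2 fun N hN => ?_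
      have := hN.isPrime
      rw [smul_mul_assoc, smul_mul_assoc]
      by_cases hNbad : d * y * m ∈ N
      · obtain ⟨v, hv⟩ := Finset.dvd_prod_of_mem t
          ((Set.Finite.mem_toFinset hbad).2 ⟨hN, hNbad⟩)
        rw [hT, hv, mul_comm, mul_smul]
        exact Submodule.smul_mem _ _ (ht N hN c hc e he)
      · refine Submodule.smul_mem _ _ ?_
        have hdN : d ∉ N := fun h => hNbad (N.mul_mem_right _ (N.mul_mem_right _ h))
        have hyN : y ∉ N := fun h => hNbad (N.mul_mem_right _ (N.mul_mem_left _ h))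
        have hmN : m ∉ N := fun h => hNbad (N.mul_mem_left _ h)
        have h1 : (1 : K) ∈ localizedAt N I := ⟨y, hyN, by rwa [Algebra.smul_def, mul_one]⟩
        have h2 : u * c * e ∈ localizedAt N (1 : Submodule R K) :=
          mul_mem_localizedAt (mul_mem_localizedAt ⟨m, hmN, hmu⟩ ⟨d, hdN, hdI c hc⟩)
            ⟨d, hdN, hdI e he⟩
        simpa using mul_mem_localizedAt h2 h1
    refine ⟨T, hTM, ?_⟩
    have hxab : T • x = a * b * T • u := by
      rw [mul_smul_comm, hu, mul_div_cancel₀ _ (mul_ne_zero ha0 hb0)]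
    rw [hxab]
    exact Submodule.mul_mem_mul (Submodule.mul_mem_mul ha hb) hTu
  · rw [← s.star_star I hI]
    refine s.star_mono _ _ hIIJ (s.star_frac _ hI) ?_
    rw [mul_assoc]
    refine Submodule.mul_le.2 fun c hc z hz => ?_
    have hle : I * J ≤ s.star I / I := Submodule.mul_le.2 fun e he x hx =>
      Submodule.mem_div_iff_forall_mul_mem.2 fun c hc => by
        rw [mul_comm e]; exact (hmemJ x).1 hx e he c hc
    rw [mul_comm]
    exact Submodule.mem_div_iff_forall_mul_mem.1 (hle hz) c hc

theorem MaxIdeal.eq_of_le {M P : Ideal R} (hM : s.MaxIdeal M) (hP : s.MaxIdeal P) (h : M ≤ P) :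
    M = P :=
  (hM.2.2 P hP.1 hP.2.1 h).symm

theorem star_mul_one_div_eq_one_of_regular (hft : s.FiniteType)
    (hinter : ∀ I J : Submodule R K, IsFrac R K I → IsFrac R K J →
      s.star (I ⊓ J) = s.star I ⊓ s.star J)
    (hint : ∀ x : K, IsIntegral R x → ∃ r : R, algebraMap R K r = x)
    {J : Submodule R K} (hJ0 : J ≠ ⊥) (hJ : J.FG) (hreg : s.Regular J) :
    s.star (J * (1 / J)) = 1 := by
  have hJf := IsFrac.of_fg hJ0 hJ
  obtain ⟨H, hH, hJH⟩ := hreg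
  have hJJH := (hJf.mul hJf).mul hH
  have hL : J * H ≤ 1 := by
    intro l hl
    rw [← s.star_one, mem_star_iff hft hinter isFrac_one]
    intro M hM
    have := hM.isPrime
    have hmap : J.map (LinearMap.mulLeft R l) ≤ localizedAt M J := by
      rintro _ ⟨x, hx, rfl⟩
      refine (mem_star_iff hft hinter hJf).1 ?_ M hM
      rw [hJH, mul_assoc, LinearMap.mulLeft_apply, mul_comm l x]
      exact s.le_star _ (mul_assoc J J H ▸ hJJH) (Submodule.mul_mem_mul hx hl)
    obtain ⟨t, ht, h⟩ := exists_smul_mem_of_fg_of_le_localizedAt (hJ.map _) hmap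
    refine ⟨t, ht, Submodule.mem_one.2 (hint _ ?_)⟩
    refine isIntegral_of_smul_mem_submodule J hJ0 hJ _ fun x hx => ?_
    rw [smul_eq_mul, smul_mul_assoc]
    exact h _ ⟨x, hx, rfl⟩
  have hHle : H ≤ 1 / J := fun h hh => Submodule.mem_div_iff_forall_mul_mem.2 fun y hy => by
    rw [mul_comm]; exact hL (Submodule.mul_mem_mul hy hh)
  have hle : J * H ≤ J * (1 / J) := Submodule.mul_le.2 fun y hy z hz =>
    Submodule.mul_mem_mul hy (hHle hz)
  have hfrac : IsFrac R K (J * (1 / J)) := isFrac_one.of_le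
    (ne_bot_of_le_ne_bot (hJf.mul hH).1 hle) (mul_one_div_le_one J)
  refine (star_eq_one_iff hfrac (mul_one_div_le_one J)).2 ((mem_star_iff hft hinter hfrac).2 ?_)
  intro M hM
  have hMp := hM.isPrime
  by_contra hcon
  have hLM : J * H ≤ idealK R K M := by
    intro l hl
    obtain ⟨r, rfl⟩ := Submodule.mem_one.1 (hL hl)
    by_contra hr
    exact hcon ⟨r, fun h => hr (mem_idealK.2 ⟨r, h, rfl⟩), by
      rw [Algebra.smul_def, mul_one]; exact hle hl⟩
  obtain ⟨t, ht, h⟩ := exists_smul_mem_of_fg_of_le_localizedAt (M := M) (I := J * J * H) hJ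
    fun x hx => (mem_star_iff hft hinter hJJH).1 (hJH ▸ s.le_star _ hJf hx) M hM
  refine ht (hMp.mem_of_smul_le hJ0 hJ fun x hx => ?_)
  have hmul : J * J * H ≤ M • J := by
    rw [mul_assoc, mul_comm]
    refine Submodule.mul_le.2 fun l hl y hy => ?_
    obtain ⟨m, hm, rfl⟩ := mem_idealK.1 (hLM hl)
    rw [← Algebra.smul_def]
    exact Submodule.smul_mem_smul hm hy
  exact hmul (h x hx)

/-- Distinct `*`-maximal ideals contain finitely generated ideals that are `*`-comaximal. -/
theorem MaxIdeal.exists_fg_comaximal (hft : s.FiniteType) {M N : Ideal R} (hM : s.MaxIdeal M)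
    (hN : s.MaxIdeal N) (hM0 : M ≠ ⊥) (hMN : M ≠ N) :
    ∃ A B : Ideal R, A.FG ∧ B.FG ∧ A ≤ M ∧ B ≤ N ∧ ∀ P, s.MaxIdeal P → A ≤ P → ¬ B ≤ P := by
  have h0 : M ⊔ N ≠ ⊥ := ne_bot_of_le_ne_bot hM0 le_sup_left
  have h1 : (1 : K) ∈ s.star (idealK R K (M ⊔ N)) := by
    by_contra h1
    obtain ⟨P, hP, h⟩ := hft.exists_le_maxIdeal h0 h1
    exact hMN ((hM.eq_of_le hP (le_sup_left.trans h)).trans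
      (hN.eq_of_le hP (le_sup_right.trans h)).symm)
  obtain ⟨F, hF0, hF, hFle, h1⟩ := hft.exists_fg_of_mem (isFrac_idealK h0) h1
  have key : ∃ A B : Ideal R, A.FG ∧ B.FG ∧ A ≤ M ∧ B ≤ N ∧ F ≤ idealK R K (A ⊔ B) := by
    clear h1 hF0
    induction F, hF using Submodule.fg_induction with
    | singleton x =>
      obtain ⟨r, hr, rfl⟩ := mem_idealK.1 (hFle (Submodule.mem_span_singleton_self x))
      obtain ⟨m, hm, n, hn, rfl⟩ := Submodule.mem_sup.1 hr
      refine ⟨Ideal.span {m}, Ideal.span {n}, Submodule.fg_span_singleton m,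
        Submodule.fg_span_singleton n, by simpa using hm, by simpa using hn, ?_⟩
      rw [Submodule.span_singleton_le_iff_mem]
      exact mem_idealK.2 ⟨_, Submodule.add_mem_sup (Ideal.mem_span_singleton_self m)
        (Ideal.mem_span_singleton_self n), rfl⟩
    | sup F G _ _ h₁ h₂ =>
      obtain ⟨A, B, hA, hB, hAM, hBN, h₁⟩ := h₁ (le_sup_left.trans hFle)
      obtain ⟨A', B', hA', hB', hAM', hBN', h₂⟩ := h₂ (le_sup_right.trans hFle)
      exact ⟨A ⊔ A', B ⊔ B', Submodule.FG.sup hA hA', Submodule.FG.sup hB hB', sup_le hAM hAM',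
        sup_le hBN hBN',
        sup_le (h₁.trans (idealK_mono (sup_le_sup le_sup_left le_sup_left)))
          (h₂.trans (idealK_mono (sup_le_sup le_sup_right le_sup_right)))⟩
  obtain ⟨A, B, hA, hB, hAM, hBN, hFAB⟩ := key
  refine ⟨A, B, hA, hB, hAM, hBN, fun P hP hAP hBP => hP.one_notMem_star ?_⟩
  have hFP := hFAB.trans (idealK_mono (sup_le hAP hBP))
  have hP0 : P ≠ ⊥ := by
    rintro rfl
    exact hF0 (by simpa [idealK] using hFP)
  have hPf := isFrac_idealK (K := K) hP0
  exact s.star_mono _ _ (hPf.of_le hF0 hFP) hPf hFP h1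

/-- If a nonzero element `r` lies in infinitely many `*`-maximal ideals then there are infinitely
many pairwise `*`-comaximal finitely generated proper `*`-ideals containing `r`. -/
theorem exists_seq_fg_comaximal (hft : s.FiniteType) {r : R} (hr : r ≠ 0)
    (hinf : {M : Ideal R | s.MaxIdeal M ∧ r ∈ M}.Infinite) :
    ∃ A : ℕ → Ideal R, (∀ n, (A n).FG ∧ r ∈ A n ∧ ∃ M, s.MaxIdeal M ∧ A n ≤ M) ∧
      ∀ m n, m ≠ n → ∀ M, s.MaxIdeal M → A m ≤ M → ¬ A n ≤ M := by
  let X := {M : Ideal R | s.MaxIdeal M ∧ r ∈ M}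
  have : Infinite X := hinf.to_subtype
  let _ : TopologicalSpace X :=
    { IsOpen := fun U => ∀ M ∈ U, ∃ A : Ideal R, A.FG ∧ A ≤ M.1 ∧ ∀ N : X, A ≤ N.1 → N ∈ U
      isOpen_univ := fun M _ => ⟨⊥, Submodule.fg_bot, bot_le, fun _ _ => trivial⟩
      isOpen_inter := by
        rintro U V hU hV M ⟨hMU, hMV⟩
        obtain ⟨A, hA, hAM, hAU⟩ := hU M hMU
        obtain ⟨B, hB, hBM, hBV⟩ := hV M hMV
        exact ⟨A ⊔ B, Submodule.FG.sup hA hB, sup_le hAM hBM, fun N hN =>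
          ⟨hAU N (le_sup_left.trans hN), hBV N (le_sup_right.trans hN)⟩⟩
      isOpen_sUnion := by
        rintro S hS M ⟨U, hU, hMU⟩
        obtain ⟨A, hA, hAM, hAU⟩ := hS U hU M hMU
        exact ⟨A, hA, hAM, fun N hN => ⟨U, hU, hAU N hN⟩⟩ }
  have : T2Space X := ⟨fun M N hMN => by
    have hM0 : M.1 ≠ ⊥ := fun h => hr (by simpa [h] using M.2.2)
    obtain ⟨A, B, hA, hB, hAM, hBN, h⟩ := MaxIdeal.exists_fg_comaximal hft M.2.1 N.2.1 hM0
      fun h => hMN (Subtype.ext h)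
    exact ⟨{P | A ≤ P.1}, {P | B ≤ P.1}, fun P hP => ⟨A, hA, hP, fun _ h => h⟩,
      fun P hP => ⟨B, hB, hP, fun _ h => h⟩, hAM, hBN,
      Set.disjoint_left.2 fun P hAP hBP => h P.1 P.2.1 hAP hBP⟩⟩
  obtain ⟨U, hUinf, hUopen, hUdisj⟩ := exists_seq_infinite_isOpen_pairwise_disjoint X
  choose M hM using fun n => (hUinf n).nonempty
  choose A hA hAM hAU using fun n => hUopen n (M n) (hM n)
  have hrspan : ∀ n, r ∈ A n ⊔ Ideal.span {r} := fun n =>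
    Ideal.mem_sup_right (Ideal.mem_span_singleton_self r)
  refine ⟨fun n => A n ⊔ Ideal.span {r}, fun n =>
    ⟨Submodule.FG.sup (hA n) (Submodule.fg_span_singleton r), hrspan n,
      (M n).1, (M n).2.1, sup_le (hAM n) ?_⟩, fun m n hmn P hP hm hn => ?_⟩
  · simpa using (M n).2.2
  · let Q : X := ⟨P, hP, hm (hrspan m)⟩
    exact Set.disjoint_left.1 (hUdisj hmn) (hAU m Q (le_sup_left.trans hm))
      (hAU n Q (le_sup_left.trans hn))

theorem finite_setOf_maxIdeal_of_regular (hft : s.FiniteType)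
    (hinter : ∀ I J : Submodule R K, IsFrac R K I → IsFrac R K J →
      s.star (I ⊓ J) = s.star I ⊓ s.star J)
    (hinv : ∀ J : Submodule R K, J ≠ ⊥ → J.FG → s.star (J * (1 / J)) = 1)
    (hreg : ∀ I : Submodule R K, IsFrac R K I → s.Regular I) {r : R} (hr : r ≠ 0) :
    {M : Ideal R | s.MaxIdeal M ∧ r ∈ M}.Finite := by
  by_contra hinf
  obtain ⟨A, hA, hcomax⟩ := exists_seq_fg_comaximal hft hr hinf
  choose hAfg hrA M hM hAM using hA
  have hA0 : ∀ n, idealK R K (A n) ≠ ⊥ := fun n => (isFrac_idealK fun h => hr (by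
    simpa [h] using hrA n)).1
  set I : Submodule R K := ⨆ n, 1 / idealK R K (A n) with hI
  have hdiv : ∀ n, 1 / idealK R K (A n) ≤ I := fun n =>
    le_iSup (fun n => 1 / idealK R K (A n)) n
  have hone : ∀ n, (1 : K) ∈ 1 / idealK R K (A n) := fun n =>
    Submodule.mem_div_iff_forall_mul_mem.2 fun y hy => by
      rw [one_mul]; exact idealK_le_one _ hy
  have hIfrac : IsFrac R K I := by
    refine isFrac_iff.2 ⟨(Submodule.ne_bot_iff _).2 ⟨1, hdiv 0 (hone 0), one_ne_zero⟩, r, hr, ?_⟩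
    have : I ≤ Submodule.comap (LinearMap.lsmul R K r) 1 := iSup_le fun n z hz => by
      have := Submodule.mem_div_iff_forall_mul_mem.1 hz _ (mem_idealK.2 ⟨r, hrA n, rfl⟩)
      rw [mul_comm, ← Algebra.smul_def] at this
      exact this
    exact this
  have hinv_loc : ∀ n P (hP : s.MaxIdeal P), haveI := hP.isPrime;
      (1 : K) ∈ localizedAt P (idealK R K (A n) * (1 / idealK R K (A n))) := fun n P hP => by
    have hne : idealK R K (A n) * (1 / idealK R K (A n)) ≠ ⊥ :=
      mul_ne_zero (hA0 n) ((Submodule.ne_bot_iff _).2 ⟨1, hone n, one_ne_zero⟩)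
    refine (mem_star_iff hft hinter (isFrac_one.of_le hne (mul_one_div_le_one _))).1 ?_ P hP
    rw [hinv _ (hA0 n) (Submodule.FG.map _ (hAfg n))]
    exact Submodule.mem_one.2 ⟨1, map_one _⟩
  have hprincipal : ∀ P (hP : s.MaxIdeal P), haveI := hP.isPrime;
      ∃ y ∈ I, y ≠ 0 ∧ ∀ z ∈ I, z / y ∈ localizedAt P (1 : Submodule R K) := by
    intro P hP
    have := hP.isPrime
    obtain ⟨y, hyI, hy0, hy1, hy⟩ : ∃ y ∈ I, y ≠ 0 ∧
        1 / y ∈ localizedAt P (1 : Submodule R K) ∧ ∀ n, A n ≤ P →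
          ∀ z ∈ 1 / idealK R K (A n), z / y ∈ localizedAt P (1 : Submodule R K) := by
      by_cases h : ∃ k, A k ≤ P
      · obtain ⟨k, hk⟩ := h
        obtain ⟨a, ha, y, hy, t, ht, hta⟩ := exists_mul_eq_of_one_mem_localizedAt (hinv_loc k P hP)
        have ht0 : algebraMap R K t ≠ 0 := fun h => ht (by
          rw [(FaithfulSMul.algebraMap_eq_zero_iff R K).1 h]; exact P.zero_mem)
        have hy0 : y ≠ 0 := by rintro rfl; simp [hta] at ht0
        have hz : ∀ z ∈ 1 / idealK R K (A k), z / y ∈ localizedAt P (1 : Submodule R K) := by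
          intro z hz
          refine ⟨t, ht, ?_⟩
          have := Submodule.mem_div_iff_forall_mul_mem.1 hz a ha
          rw [Algebra.smul_def, hta]
          convert this using 1
          field_simp
        refine ⟨y, hdiv k hy, hy0, hz 1 (hone k), fun n hn => ?_⟩
        have hnk : n = k := by
          by_contra hnk
          exact hcomax n k hnk P hP hn hk
        exact hnk ▸ hz
      · exact ⟨1, hdiv 0 (hone 0), one_ne_zero, by simpa using one_mem_localizedAt_one,
          fun n hn => absurd ⟨n, hn⟩ h⟩
    refine ⟨y, hyI, hy0, fun z hz => ?_⟩
    have hle : I ≤ Submodule.comap (LinearMap.mulRight R y⁻¹) (localizedAt P 1) := by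
      refine iSup_le fun n w hw => ?_
      by_cases hn : A n ≤ P
      · have := hy n hn w hw
        rwa [div_eq_mul_inv] at this
      · have := mul_mem_localizedAt (one_div_idealK_le_localizedAt hn hw) hy1
        simpa using this
    rw [div_eq_mul_inv]
    exact hle hz
  obtain ⟨J, hJ, hIJ⟩ := hreg I hIfrac
  have hIIJ := (hIfrac.mul hIfrac).mul hJ
  have hIJle : I * J ≤ 1 := by
    intro x hx
    rw [← s.star_one, mem_star_iff hft hinter isFrac_one]
    intro P hP
    have := hP.isPrime
    obtain ⟨y, hyI, hy0, hy⟩ := hprincipal P hP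
    have hyx : y * x ∈ s.star I := by
      rw [hIJ, mul_assoc]
      exact s.le_star _ (mul_assoc I I J ▸ hIIJ) (Submodule.mul_mem_mul hyI hx)
    obtain ⟨t, ht, htx⟩ := (mem_star_iff hft hinter hIfrac).1 hyx P hP
    have := hy _ htx
    rw [smul_div_assoc, mul_div_cancel_left₀ _ hy0] at this
    exact mem_localizedAt_of_smul_mem ht this
  have hIJfrac := hIfrac.mul hJ
  have h1 : (1 : K) ∈ s.star (I * J) := by
    rw [mem_star_iff hft hinter hIJfrac]
    intro P hP
    have := hP.isPrime
    obtain ⟨y, hyI, hy0, hy⟩ := hprincipal P hP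
    obtain ⟨t, ht, hty⟩ := (mem_star_iff hft hinter hIIJ).1 (hIJ ▸ s.le_star _ hIfrac hyI) P hP
    refine mem_localizedAt_of_smul_mem ht ?_
    have hle : I * (I * J) ≤
        Submodule.comap (LinearMap.mulRight R y⁻¹) (localizedAt P (I * J)) := by
      refine Submodule.mul_le.2 fun z hz w hw => ?_
      have := mul_mem_localizedAt (hy z hz) (le_localizedAt hw)
      rwa [div_mul_eq_mul_div, div_eq_mul_inv] at this
    rw [mul_assoc] at hty
    have := hle hty
    rw [Submodule.mem_comap, LinearMap.mulRight_apply, smul_mul_assoc, mul_inv_cancel₀ hy0] at this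
    exact this
  obtain ⟨F, hF0, hF, hFle, h1⟩ := hft.exists_fg_of_mem hIJfrac h1
  rw [hI, Submodule.iSup_mul] at hFle
  obtain ⟨S, hS⟩ := CompleteLattice.IsCompactElement.exists_finset_of_le_iSup _
    ((Submodule.fg_iff_compact F).1 hF) _ hFle
  obtain ⟨k, hk⟩ := Infinite.exists_notMem_finset S
  have hMp := (hM k).isPrime
  have hFloc : F ≤ localizedAt (M k) J := by
    refine hS.trans (iSup₂_le fun n hn => Submodule.mul_le.2 fun z hz w hw => ?_)
    have hnk : ¬ A n ≤ M k := hcomax k n (fun h => hk (h ▸ hn)) _ (hM k) (hAM k)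
    exact mul_mem_localizedAt (one_div_idealK_le_localizedAt hnk hz) (le_localizedAt hw)
  obtain ⟨t, ht, htJ⟩ := localizedAt_localizedAt_le (localizedAt_mono hFloc
    ((mem_star_iff hft hinter (IsFrac.of_fg hF0 hF)).1 h1 (M k) (hM k)))
  obtain ⟨a, ha, z, hz, q, hq, hqa⟩ :=
    exists_mul_eq_of_one_mem_localizedAt (hinv_loc k (M k) (hM k))
  obtain ⟨c, hc⟩ := Submodule.mem_one.1 (hIJle (Submodule.mul_mem_mul (hdiv k hz) htJ))
  obtain ⟨b, hb, rfl⟩ := mem_idealK.1 ha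
  have htq : t * q = b * c := IsFractionRing.injective R K (by
    rw [map_mul, map_mul, hc, hqa, Algebra.smul_def]; ring)
  have hmem : t * q ∈ M k := htq ▸ (M k).mul_mem_right _ (hAM k hb)
  exact (hMp.mem_or_mem hmem).elim ht hq

end StarOperation

/-- Let `*` be a star operation on `R` which is spectral and of finite type
(i.e. of finite type and distributing over finite intersections). Then `R` is integrally
closed and Clifford `*`-regular if and only if `R` is a Prüfer `*`-multiplication domain
(`(J(R : J))^* = R` for every nonzero finitely generated ideal `J`) with `*`-finite
character. -/
theorem integrally_closed_clifford_regular_iff_pstarmd_finite_character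
    {R K : Type*} [CommRing R] [IsDomain R] [Field K] [Algebra R K] [IsFractionRing R K]
    (s : StarOperation R K) (hft : s.FiniteType)
    (hinter : ∀ I J : Submodule R K, IsFrac R K I → IsFrac R K J →
      s.star (I ⊓ J) = s.star I ⊓ s.star J) :
    ((∀ x : K, IsIntegral R x → ∃ r : R, algebraMap R K r = x) ∧
        ∀ I : Submodule R K, IsFrac R K I → s.Regular I) ↔
      ((∀ J : Submodule R K, J ≠ ⊥ → J.FG → s.star (J * (1 / J)) = 1) ∧
        ∀ r : R, r ≠ 0 → {M : Ideal R | s.MaxIdeal M ∧ r ∈ M}.Finite) := by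
  refine ⟨fun ⟨hint, hreg⟩ => ?_, fun ⟨hinv, hfin⟩ => ?_⟩
  · have hinv : ∀ J : Submodule R K, J ≠ ⊥ → J.FG → s.star (J * (1 / J)) = 1 :=
      fun J hJ0 hJ => StarOperation.star_mul_one_div_eq_one_of_regular hft hinter hint hJ0 hJ
        (hreg J (IsFrac.of_fg hJ0 hJ))
    exact ⟨hinv, fun r hr =>
      StarOperation.finite_setOf_maxIdeal_of_regular hft hinter hinv hreg hr⟩
  · refine ⟨fun x => StarOperation.exists_algebraMap_eq_of_isIntegral hinv, fun I hI =>
      StarOperation.regular_of_isValuationAt hft hinter (fun M hM => ?_) hfin hI⟩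
    have := hM.isPrime
    refine isValuationAt_of_one_mem_localizedAt fun x => ?_
    set J : Submodule R K := Submodule.span R {1, x}
    have hJ0 : J ≠ ⊥ :=
      (Submodule.ne_bot_iff _).2 ⟨1, Submodule.subset_span (by simp), one_ne_zero⟩
    have hJ : J.FG := Submodule.fg_span (by simp)
    have hfrac : IsFrac R K (J * (1 / J)) := isFrac_one.of_le
      (IsFrac.of_fg hJ0 hJ).mul_one_div_ne_bot (mul_one_div_le_one J)
    refine (StarOperation.mem_star_iff hft hinter hfrac).1 ?_ M hM
    rw [hinv J hJ0 hJ]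
    exact Submodule.mem_one.2 ⟨1, map_one _⟩
end
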